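/- arXiv:2605.18870 — 7 statements merged into one kernel-verified Lean document; each statement's English description precedes it below -/
import Mathlib

section
/- Let (Ω, 𝒜, Ξ) be a probability space, k ≥ 1, and let m : Ω → ℝ be measurable with c ≤ m(θ) ≤ c̄ for all θ ∈ Ω, where 0 < c ≤ c̄. Set b = (∫_Ω m(θ)^{-1} dΞ(θ))^{-1}. Then for every v ∈ ℝ^k and every Bochner-integrable U : Ω → ℝ^k with ∫_Ω U dΞ = v, one has ∫_Ω m(θ)·‖U(θ)‖² dΞ(θ) ≥ b·‖v‖². -/
open MeasureTheory

/-- Integrating the tangent-line bound `m x² ≥ 2 t x - t² / m`. -/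
lemma ofReal_two_mul_integral_norm_sub_le_lintegral
    {Ω E : Type*} [MeasurableSpace Ω] [NormedAddCommGroup E] {μ : Measure Ω}
    {m : Ω → ℝ} (hm : ∀ θ, 0 < m θ) (hinv : Integrable (fun θ => (m θ)⁻¹) μ)
    {U : Ω → E} (hU : Integrable U μ) (t : ℝ) :
    ENNReal.ofReal (2 * t * (∫ θ, ‖U θ‖ ∂μ) - t ^ 2 * ∫ θ, (m θ)⁻¹ ∂μ)
      ≤ ∫⁻ θ, ENNReal.ofReal (m θ * ‖U θ‖ ^ 2) ∂μ := by
  have hg : Integrable (fun θ => 2 * t * ‖U θ‖ - t ^ 2 * (m θ)⁻¹) μ :=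
    (hU.norm.const_mul _).sub (hinv.const_mul _)
  rw [← integral_const_mul, ← integral_const_mul,
    ← integral_sub (hU.norm.const_mul _) (hinv.const_mul _)]
  calc
    _ ≤ ENNReal.ofReal (∫ θ, max (2 * t * ‖U θ‖ - t ^ 2 * (m θ)⁻¹) 0 ∂μ) :=
      ENNReal.ofReal_le_ofReal (integral_mono hg hg.pos_part fun _ => le_max_left _ _)
    _ = ∫⁻ θ, ENNReal.ofReal (max (2 * t * ‖U θ‖ - t ^ 2 * (m θ)⁻¹) 0) ∂μ :=
      ofReal_integral_eq_lintegral_ofReal hg.pos_part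
        (Filter.Eventually.of_forall fun _ => le_max_right _ _)
    _ ≤ _ := by
      refine lintegral_mono fun θ => ENNReal.ofReal_le_ofReal (max_le ?_ ?_)
      · have hsq : m θ * ‖U θ‖ ^ 2 - (2 * t * ‖U θ‖ - t ^ 2 * (m θ)⁻¹)
            = (m θ)⁻¹ * (m θ * ‖U θ‖ - t) ^ 2 := by
          have := (hm θ).ne'
          field_simp
          ring
        have : 0 ≤ (m θ)⁻¹ * (m θ * ‖U θ‖ - t) ^ 2 :=
          mul_nonneg (inv_nonneg.2 (hm θ).le) (sq_nonneg _)
        linarith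
      · exact mul_nonneg (hm θ).le (sq_nonneg _)

/-- **Fiberwise constrained quadratic minimization, lower bound.**
If `c ≤ m ≤ c̄` with `0 < c`, `b = (∫ 1/m dΞ)⁻¹` is the `Ξ`-weighted harmonic
mean of `m`, and `U` is Bochner integrable with `∫ U dΞ = v`, then the weighted
kinetic cost `∫ m ‖U‖² dΞ` (as an extended-real integral) is at least `b ‖v‖²`. -/
theorem harmonic_mean_lower_bound
    {Ω : Type*} [MeasurableSpace Ω] (Ξ : Measure Ω) [IsProbabilityMeasure Ξ]
    (k : ℕ) (hk : 1 ≤ k) (m : Ω → ℝ) (hm : Measurable m)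
    (c cbar : ℝ) (hc : 0 < c) (hccbar : c ≤ cbar)
    (hbounds : ∀ θ, c ≤ m θ ∧ m θ ≤ cbar)
    (v : EuclideanSpace ℝ (Fin k)) (U : Ω → EuclideanSpace ℝ (Fin k))
    (hU : Integrable U Ξ) (hmean : (∫ θ, U θ ∂Ξ) = v) :
    ENNReal.ofReal ((∫ θ, (m θ)⁻¹ ∂Ξ)⁻¹ * ‖v‖ ^ 2)
      ≤ ∫⁻ θ, ENNReal.ofReal (m θ * ‖U θ‖ ^ 2) ∂Ξ := by
  have hmpos : ∀ θ, 0 < m θ := fun θ => hc.trans_le (hbounds θ).1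
  have hinv : Integrable (fun θ => (m θ)⁻¹) Ξ := by
    refine Integrable.of_bound hm.inv.aestronglyMeasurable c⁻¹
      (Filter.Eventually.of_forall fun θ => ?_)
    rw [Real.norm_of_nonneg (inv_nonneg.2 (hmpos θ).le)]
    exact inv_anti₀ hc (hbounds θ).1
  have hI : 0 ≤ ∫ θ, (m θ)⁻¹ ∂Ξ := integral_nonneg fun θ => inv_nonneg.2 (hmpos θ).le
  have hv : ‖v‖ ≤ ∫ θ, ‖U θ‖ ∂Ξ := hmean ▸ norm_integral_le_integral_norm U
  refine le_trans (ENNReal.ofReal_le_ofReal ?_)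
    (ofReal_two_mul_integral_norm_sub_le_lintegral hmpos hinv hU
      ((∫ θ, (m θ)⁻¹ ∂Ξ)⁻¹ * ‖v‖))
  set I := ∫ θ, (m θ)⁻¹ ∂Ξ
  have hmul := mul_le_mul_of_nonneg_left hv (mul_nonneg (inv_nonneg.2 hI) (norm_nonneg v))
  have hquad : (I⁻¹ * ‖v‖) ^ 2 * I = I⁻¹ * ‖v‖ ^ 2 := by
    rcases eq_or_ne I 0 with h | h
    · simp [h]
    · field_simp
  rw [hquad]
  linarith
end

section
/- Let (Ω, 𝒜, Ξ) be a probability space, k ≥ 1, and let m : Ω → ℝ be measurable with c ≤ m(θ) ≤ c̄ for all θ ∈ Ω, where 0 < c ≤ c̄. Set b = (∫_Ω m(θ)^{-1} dΞ(θ))^{-1} and, for v ∈ ℝ^k, define U*(θ) = b·v/m(θ). Then ∫_Ω U* dΞ = v and ∫_Ω m(θ)·‖U*(θ)‖² dΞ(θ) = b·‖v‖²; moreover, any Bochner-integrable U : Ω → ℝ^k with ∫_Ω U dΞ = v and ∫_Ω m(θ)·‖U(θ)‖² dΞ(θ) = b·‖v‖² satisfies U = U* Ξ-almost everywhere. -/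
open MeasureTheory

theorem integrable_inv_of_le {Ω : Type*} [MeasurableSpace Ω] {μ : Measure Ω} [IsFiniteMeasure μ]
    {m : Ω → ℝ} (hm : Measurable m) {c : ℝ} (hc : 0 < c) (hle : ∀ θ, c ≤ m θ) :
    Integrable (fun θ => (m θ)⁻¹) μ := by
  refine Integrable.of_bound hm.inv.aestronglyMeasurable c⁻¹ (ae_of_all _ fun θ => ?_)
  rw [Real.norm_of_nonneg (inv_nonneg.2 (hc.le.trans (hle θ)))]
  exact inv_anti₀ hc (hle θ)

/-- Completing the square in the weighted kinetic cost around the profile `(b / a) • v`. -/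
theorem mul_norm_sub_div_smul_sq {E : Type*} [NormedAddCommGroup E] [InnerProductSpace ℝ E]
    {a : ℝ} (ha : a ≠ 0) (b : ℝ) (u v : E) :
    a * ‖u - (b / a) • v‖ ^ 2 =
      a * ‖u‖ ^ 2 - 2 * b * inner ℝ v u + b ^ 2 * ‖v‖ ^ 2 * a⁻¹ := by
  rw [norm_sub_sq_real, inner_smul_right, norm_smul, mul_pow, Real.norm_eq_abs, sq_abs,
    real_inner_comm]
  field_simp

/-- **Fiberwise constrained quadratic minimization: the unique minimizer.**
With `b` the `Ξ`-weighted harmonic mean of the mobility `m` and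
`U*(θ) = (b / m θ) • v`, one has `∫ U* dΞ = v`, the cost of `U*` equals
`b ‖v‖²`, and any integrable competitor with the same mean attaining the same
cost coincides with `U*` Ξ-almost everywhere. -/
theorem harmonic_mean_minimizer
    {Ω : Type*} [MeasurableSpace Ω] (Ξ : Measure Ω) [IsProbabilityMeasure Ξ]
    (k : ℕ) (hk : 1 ≤ k) (m : Ω → ℝ) (hm : Measurable m)
    (c cbar : ℝ) (hc : 0 < c) (hccbar : c ≤ cbar)
    (hbounds : ∀ θ, c ≤ m θ ∧ m θ ≤ cbar)
    (v : EuclideanSpace ℝ (Fin k))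
    (b : ℝ) (hb : b = (∫ θ, (m θ)⁻¹ ∂Ξ)⁻¹)
    (Ustar : Ω → EuclideanSpace ℝ (Fin k))
    (hUstar : ∀ θ, Ustar θ = (b / m θ) • v) :
    (∫ θ, Ustar θ ∂Ξ) = v ∧
    (∫ θ, m θ * ‖Ustar θ‖ ^ 2 ∂Ξ) = b * ‖v‖ ^ 2 ∧
    (∀ U : Ω → EuclideanSpace ℝ (Fin k), Integrable U Ξ →
      Integrable (fun θ => m θ * ‖U θ‖ ^ 2) Ξ →
      (∫ θ, U θ ∂Ξ) = v → (∫ θ, m θ * ‖U θ‖ ^ 2 ∂Ξ) = b * ‖v‖ ^ 2 →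
      ∀ᵐ θ ∂Ξ, U θ = Ustar θ) := by
  have hpos : ∀ θ, 0 < m θ := fun θ => hc.trans_le (hbounds θ).1
  have hint : Integrable (fun θ => (m θ)⁻¹) Ξ :=
    integrable_inv_of_le hm hc fun θ => (hbounds θ).1
  have hinv_pos : 0 < ∫ θ, (m θ)⁻¹ ∂Ξ := by
    have hle : ∫ _, cbar⁻¹ ∂Ξ ≤ ∫ θ, (m θ)⁻¹ ∂Ξ :=
      integral_mono (integrable_const _) hint fun θ => inv_anti₀ (hpos θ) (hbounds θ).2
    have hcbar : 0 < cbar⁻¹ := inv_pos.2 (hc.trans_le hccbar)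
    simp only [integral_const, probReal_univ, one_smul] at hle
    exact hcbar.trans_le hle
  have hb_mul : b * ∫ θ, (m θ)⁻¹ ∂Ξ = 1 := by rw [hb, inv_mul_cancel₀ hinv_pos.ne']
  refine ⟨?_, ?_, fun U hU hcost hmean heq => ?_⟩
  · simp_rw [hUstar, div_eq_mul_inv]
    rw [integral_smul_const, integral_const_mul, hb_mul, one_smul]
  · have hfiber : ∀ θ, m θ * ‖Ustar θ‖ ^ 2 = b ^ 2 * ‖v‖ ^ 2 * (m θ)⁻¹ := fun θ => by
      have := (hpos θ).ne'
      rw [hUstar, norm_smul, mul_pow, Real.norm_eq_abs, sq_abs]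
      field_simp
    simp_rw [hfiber]
    rw [integral_const_mul]
    linear_combination b * ‖v‖ ^ 2 * hb_mul
  · have hsquare : ∀ θ, m θ * ‖U θ - Ustar θ‖ ^ 2 =
        m θ * ‖U θ‖ ^ 2 - 2 * b * inner ℝ v (U θ) + b ^ 2 * ‖v‖ ^ 2 * (m θ)⁻¹ := fun θ => by
      rw [hUstar, mul_norm_sub_div_smul_sq (hpos θ).ne']
    have hinner : Integrable (fun θ => 2 * b * inner ℝ v (U θ)) Ξ :=
      (hU.const_inner v).const_mul _
    have hsub : Integrable (fun θ => m θ * ‖U θ‖ ^ 2 - 2 * b * inner ℝ v (U θ)) Ξ :=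
      hcost.sub hinner
    have hlast : Integrable (fun θ => b ^ 2 * ‖v‖ ^ 2 * (m θ)⁻¹) Ξ := hint.const_mul _
    have hzero : ∫ θ, m θ * ‖U θ - Ustar θ‖ ^ 2 ∂Ξ = 0 := by
      simp_rw [hsquare]
      rw [integral_add hsub hlast, integral_sub hcost hinner, integral_const_mul,
        integral_const_mul, integral_inner hU, hmean, heq, real_inner_self_eq_norm_sq]
      linear_combination b * ‖v‖ ^ 2 * hb_mul
    have hdiff : Integrable (fun θ => m θ * ‖U θ - Ustar θ‖ ^ 2) Ξ := by
      simp_rw [hsquare]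
      exact hsub.add hlast
    have hnonneg : ∀ θ, 0 ≤ m θ * ‖U θ - Ustar θ‖ ^ 2 := fun θ =>
      mul_nonneg (hpos θ).le (sq_nonneg _)
    filter_upwards [(integral_eq_zero_iff_of_nonneg hnonneg hdiff).1 hzero] with θ hθ
    simpa [(hpos θ).ne', sub_eq_zero] using hθ
end

section
/- Let (X, d) be a metric space, T > 0, N ≥ 1, τ = T/N, and t_k = kτ for k = 0, …, N. Let E : X × [0, T] → ℝ, let u⁰ ∈ X, and for each k = 1, …, N let u^k minimize x ↦ d²(x, u^{k−1})/(2τ) + E(x, t_k) over X. Then E(u^N, T) + Σ_{k=1}^{N} d²(u^k, u^{k−1})/(2τ) ≤ E(u⁰, 0) + Σ_{k=0}^{N−1} [E(u^k, t_{k+1}) − E(u^k, t_k)]. -/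
open Finset

/-- **Discrete energy estimate for the time-dependent minimizing-movement (JKO) scheme.**
With uniform step `τ = T/N`, nodes `t_k = k τ`, and each `u^k` minimizing
`x ↦ d²(x, u^{k−1})/(2τ) + E(x, t_k)`, one has
`E(u^N, T) + Σ_k d²(u^k, u^{k−1})/(2τ) ≤ E(u⁰, 0) + Σ_k [E(u^k, t_{k+1}) − E(u^k, t_k)]`. -/
theorem discrete_energy_estimate
    {X : Type*} [MetricSpace X] (T : ℝ) (hT : 0 < T) (N : ℕ) (hN : 1 ≤ N)
    (E : X → ℝ → ℝ) (u : ℕ → X)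
    (hmin : ∀ k : ℕ, 1 ≤ k → k ≤ N → ∀ x : X,
      dist (u k) (u (k - 1)) ^ 2 / (2 * (T / N)) + E (u k) ((k : ℝ) * (T / N)) ≤
      dist x (u (k - 1)) ^ 2 / (2 * (T / N)) + E x ((k : ℝ) * (T / N))) :
    E (u N) T + ∑ k ∈ Finset.Icc 1 N, dist (u k) (u (k - 1)) ^ 2 / (2 * (T / N)) ≤
      E (u 0) 0 + ∑ k ∈ Finset.range N,
        (E (u k) (((k : ℝ) + 1) * (T / N)) - E (u k) ((k : ℝ) * (T / N))) := by
  have key : ∀ n ≤ N,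
      E (u n) ((n : ℝ) * (T / N)) +
          ∑ k ∈ Finset.Icc 1 n, dist (u k) (u (k - 1)) ^ 2 / (2 * (T / N)) ≤
        E (u 0) 0 + ∑ k ∈ Finset.range n,
          (E (u k) (((k : ℝ) + 1) * (T / N)) - E (u k) ((k : ℝ) * (T / N))) := by
    intro n
    induction n with
    | zero => simp
    | succ n ih =>
      intro hn
      have hprev := ih (by omega)
      have hstep := hmin (n + 1) (by omega) hn (u n)
      rw [Finset.sum_Icc_succ_top (by omega), Finset.sum_range_succ]
      simp only [Nat.add_sub_cancel, dist_self, Nat.cast_add, Nat.cast_one] at hstep ⊢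
      norm_num at hstep
      linarith
  have hN' : (N : ℝ) ≠ 0 := by exact_mod_cast (by omega : N ≠ 0)
  simpa only [mul_div_cancel₀ T hN'] using key N le_rfl
end

section
/- Let (X, d) be a compact metric space, T > 0, and E : X × [0, T] → ℝ such that E(·, t) is lower semicontinuous for every t ∈ [0, T] and there exists a nonnegative g ∈ L¹(0, T) with |E(x, r) − E(x, s)| ≤ ∫_s^r g(ρ) dρ for all x ∈ X and all 0 ≤ s ≤ r ≤ T. Fix x₀ ∈ X. For each n ∈ ℕ let τ_n = T/2ⁿ, t_k = k·τ_n, and define the piecewise-constant minimizing-movement interpolant u_n : [0, T] → X by u_n(0) = x₀ and u_n(t) = u_n^k for t ∈ (t_{k−1}, t_k], where u_n^0 = x₀ and each u_n^k minimizes x ↦ d²(x, u_n^{k−1})/(2τ_n) + E(x, t_k) over X. Then there exist a subsequence (u_{n_j}) and a curve u : [0, T] → X such that u_{n_j}(t) → u(t) for every t ∈ [0, T], and u satisfies the ½-Hölder estimate d(u(s), u(r)) ≤ (2C̄)^{1/2}·|r − s|^{1/2} for all s, r ∈ [0, T], where C̄ = E(x₀, 0) − inf_{X×[0,T]} E + ∫₀^T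 g(ρ) dρ. -/
open Filter Topology Set MeasureTheory

/-- **Refined Arzelà–Ascoli theorem.** A sequence of maps into a compact metric space which is
equicontinuous up to errors `ε n → 0` has a pointwise convergent subsequence, and the limit has
modulus of continuity `ω`. -/
theorem exists_subseq_tendsto_of_asymptotic_modulus
    {α X : Type*} [PseudoMetricSpace α] [TopologicalSpace.SeparableSpace α]
    [MetricSpace X] [CompactSpace X] (f : ℕ → α → X) (ω : ℝ → ℝ) (hω : Continuous ω)
    (hω0 : ω 0 = 0) (ε : ℕ → ℝ) (hε : Tendsto ε atTop (𝓝 0))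
    (hf : ∀ n s t, dist (f n s) (f n t) ≤ ω (dist s t + ε n)) :
    ∃ (φ : ℕ → ℕ) (u : α → X), StrictMono φ ∧
      (∀ t, Tendsto (fun j => f (φ j) t) atTop (𝓝 (u t))) ∧
      ∀ s t, dist (u s) (u t) ≤ ω (dist s t) := by
  obtain ⟨D, hDc, hDd⟩ := TopologicalSpace.exists_countable_dense α
  have := hDc.to_subtype
  obtain ⟨v, φ, hφ, hv⟩ := CompactSpace.tendsto_subseq (fun n (q : D) => f n q)
  rw [tendsto_pi_nhds] at hv
  have hεφ : Tendsto (fun j => ε (φ j)) atTop (𝓝 0) := hε.comp hφ.tendsto_atTop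
  have hmod : ∀ s t : α, Tendsto (fun j => ω (dist s t + ε (φ j))) atTop (𝓝 (ω (dist s t))) := by
    intro s t
    have := (hω.tendsto (dist s t + 0)).comp (hεφ.const_add (dist s t))
    simpa [Function.comp_def] using this
  have hcauchy : ∀ t, CauchySeq (fun j => f (φ j) t) := by
    intro t
    rw [Metric.cauchySeq_iff']
    intro η hη
    have hsmall : ∀ᶠ q in 𝓝 t, ω (dist t q) < η / 4 := by
      have hcont : Continuous fun q => ω (dist t q) := by fun_prop
      refine (hcont.tendsto t).eventually_lt_const ?_
      rw [dist_self, hω0]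
      positivity
    obtain ⟨q, hqD, hq⟩ := hDd.inter_nhds_nonempty hsmall
    have hqt : ∀ᶠ j in atTop, dist (f (φ j) t) (f (φ j) q) < η / 4 :=
      ((hmod t q).eventually_lt_const hq).mono fun j hj => (hf _ _ _).trans_lt hj
    have hqc : ∀ᶠ j in atTop, dist (f (φ j) q) (v ⟨q, hqD⟩) < η / 4 :=
      (hv ⟨q, hqD⟩).eventually (Metric.ball_mem_nhds _ (by positivity))
    obtain ⟨N, hN⟩ := eventually_atTop.1 (hqt.and hqc)
    refine ⟨N, fun j hj => ?_⟩
    have h1 := hN j hj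
    have h2 := hN N le_rfl
    have h3 := dist_triangle4_right (f (φ j) t) (f (φ N) t) (f (φ j) q) (f (φ N) q)
    have h4 := dist_triangle_right (f (φ j) q) (f (φ N) q) (v ⟨q, hqD⟩)
    linarith [h1.1, h1.2, h2.1, h2.2]
  choose u hu using fun t => cauchySeq_tendsto_of_complete (hcauchy t)
  exact ⟨φ, u, hφ, hu, fun s t => le_of_tendsto_of_tendsto' ((hu s).dist (hu t)) (hmod s t)
    fun j => hf _ _ _⟩

/-- Discrete energy inequality along a minimizing-movement scheme with step `τ`. -/
theorem sum_dist_sq_div_add_energy_le {X : Type*} [PseudoMetricSpace X] {T τ : ℝ} (hτ : 0 ≤ τ)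
    {E : X → ℝ → ℝ} {g : ℝ → ℝ} (hg : IntervalIntegrable g volume 0 T)
    (hosc : ∀ x : X, ∀ s r : ℝ, 0 ≤ s → s ≤ r → r ≤ T → |E x r - E x s| ≤ ∫ ρ in s..r, g ρ)
    {V : ℕ → X} {N : ℕ} (hN : N * τ ≤ T)
    (hV : ∀ k < N, dist (V k) (V (k + 1)) ^ 2 / (2 * τ) + E (V (k + 1)) ((k + 1 : ℕ) * τ) ≤
      E (V k) ((k + 1 : ℕ) * τ)) :
    ∑ k ∈ Finset.range N, dist (V k) (V (k + 1)) ^ 2 / (2 * τ) + E (V N) (N * τ) ≤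
      E (V 0) 0 + ∫ ρ in (0 : ℝ)..N * τ, g ρ := by
  induction N with
  | zero => simp
  | succ N ih =>
    have h0 : (0 : ℝ) ≤ N * τ := by positivity
    have h1 : (N : ℝ) * τ ≤ (N + 1 : ℕ) * τ := by gcongr; simp
    have hsub : ∀ a b : ℝ, 0 ≤ a → a ≤ b → b ≤ T → IntervalIntegrable g volume a b :=
      fun a b ha hab hb => hg.mono_set <| by
        rw [uIcc_of_le hab, uIcc_of_le (ha.trans (hab.trans hb))]
        exact Icc_subset_Icc ha hb
    have hsplit := intervalIntegral.integral_add_adjacent_intervals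
      (hsub 0 (N * τ) le_rfl h0 (h1.trans hN)) (hsub _ _ h0 h1 hN)
    have h2 := ih (h1.trans hN) fun k hk => hV k (hk.trans N.lt_succ_self)
    have h3 := hV N N.lt_succ_self
    have h4 := (abs_le.1 (hosc (V N) _ _ h0 h1 hN)).2
    rw [Finset.sum_range_succ]
    linarith

/-- By Cauchy–Schwarz, a bound on the sum of squared steps controls the distance
between any two points of a sequence. -/
theorem dist_sq_le_mul_of_sum_dist_sq_le {X : Type*} [PseudoMetricSpace X] {V : ℕ → X} {N : ℕ}
    {A : ℝ} (hA : ∑ k ∈ Finset.range N, dist (V k) (V (k + 1)) ^ 2 ≤ A) {i k : ℕ} (hik : i ≤ k)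
    (hk : k ≤ N) : dist (V i) (V k) ^ 2 ≤ ((k : ℝ) - i) * A := by
  calc dist (V i) (V k) ^ 2 ≤ (∑ j ∈ Finset.Ico i k, dist (V j) (V (j + 1))) ^ 2 := by
        gcongr
        exact dist_le_Ico_sum_dist V hik
    _ ≤ (Finset.Ico i k).card * ∑ j ∈ Finset.Ico i k, dist (V j) (V (j + 1)) ^ 2 :=
        sq_sum_le_card_mul_sum_sq
    _ ≤ ((k : ℝ) - i) * A := by
        rw [Nat.card_Ico, Nat.cast_sub hik]
        have : (0 : ℝ) ≤ (k : ℝ) - i := sub_nonneg.2 (by exact_mod_cast hik)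
        gcongr
        refine le_trans (Finset.sum_le_sum_of_subset_of_nonneg ?_ fun _ _ _ => by positivity) hA
        intro j hj
        rw [Finset.mem_Ico] at hj
        exact Finset.mem_range.2 (hj.2.trans_le hk)

/-- An energy which is lower semicontinuous at time `0` and has integrable time oscillation is
bounded below on `[0, T]`. -/
theorem bddBelow_energy {X : Type*} [TopologicalSpace X] [CompactSpace X] {T : ℝ}
    {E : X → ℝ → ℝ} (hlsc : LowerSemicontinuous fun x => E x 0) {g : ℝ → ℝ} (hg0 : ∀ ρ, 0 ≤ g ρ)
    (hg : IntervalIntegrable g volume 0 T)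
    (hosc : ∀ x : X, ∀ s r : ℝ, 0 ≤ s → s ≤ r → r ≤ T → |E x r - E x s| ≤ ∫ ρ in s..r, g ρ) :
    BddBelow {e : ℝ | ∃ x, ∃ t ∈ Icc (0 : ℝ) T, e = E x t} := by
  obtain ⟨m, hm⟩ := (hlsc.lowerSemicontinuousOn univ).bddBelow_of_isCompact isCompact_univ
  refine ⟨m - ∫ ρ in (0 : ℝ)..T, g ρ, ?_⟩
  rintro e ⟨x, t, ht, rfl⟩
  have h1 : m ≤ E x 0 := hm (mem_image_of_mem _ (mem_univ x))
  have h2 := (abs_le.1 (hosc x 0 t le_rfl ht.1 ht.2)).1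
  have h3 : ∫ ρ in (0 : ℝ)..t, g ρ ≤ ∫ ρ in (0 : ℝ)..T, g ρ :=
    intervalIntegral.integral_mono_interval le_rfl ht.1 ht.2 (ae_of_all _ hg0) hg
  linarith

/-- Rounding up to a grid of step `τ` increases the distance of two times by at most `τ`. -/
theorem ceil_div_sub_ceil_div_mul_le {s t τ : ℝ} (hτ : 0 < τ) (ht : 0 ≤ t) :
    ((⌈t / τ⌉₊ : ℝ) - ⌈s / τ⌉₊) * τ ≤ t - s + τ := by
  have h1 := Nat.ceil_lt_add_one (div_nonneg ht hτ.le)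
  have h2 := Nat.le_ceil (s / τ)
  calc ((⌈t / τ⌉₊ : ℝ) - ⌈s / τ⌉₊) * τ ≤ (t / τ + 1 - s / τ) * τ := by gcongr
    _ = t - s + τ := by field_simp; ring

/-- **Compactness of time-dependent minimizing movements.**
On a compact metric space, with energies `E(·,t)` lower semicontinuous and
time-oscillation controlled by an `L¹` density `g`, the piecewise-constant
minimizing-movement interpolants along the dyadic partitions of `[0,T]`
(with `u_n(t) = u_n^{⌈t/τ_n⌉}`, `τ_n = T/2ⁿ`) admit a subsequence converging
pointwise on `[0,T]` to a limit curve satisfying the `½`-Hölder estimate with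
constant `(2 C̄)^{1/2}`, `C̄ = E(x₀,0) − inf E + ∫₀ᵀ g`. -/
theorem minimizing_movements_compactness
    {X : Type*} [MetricSpace X] [CompactSpace X]
    (T : ℝ) (hT : 0 < T) (E : X → ℝ → ℝ)
    (hlsc : ∀ t ∈ Icc (0:ℝ) T, LowerSemicontinuous (fun x => E x t))
    (g : ℝ → ℝ) (hg0 : ∀ ρ, 0 ≤ g ρ) (hgint : IntegrableOn g (Icc 0 T))
    (hosc : ∀ x : X, ∀ s r : ℝ, 0 ≤ s → s ≤ r → r ≤ T →
      |E x r - E x s| ≤ ∫ ρ in s..r, g ρ)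
    (x0 : X) (U : ℕ → ℕ → X) (hU0 : ∀ n, U n 0 = x0)
    (hUmin : ∀ n k, 1 ≤ k → k ≤ 2 ^ n → ∀ x : X,
      dist (U n k) (U n (k - 1)) ^ 2 / (2 * (T / 2 ^ n))
          + E (U n k) ((k : ℝ) * (T / 2 ^ n)) ≤
        dist x (U n (k - 1)) ^ 2 / (2 * (T / 2 ^ n))
          + E x ((k : ℝ) * (T / 2 ^ n))) :
    ∃ (φ : ℕ → ℕ) (u : ℝ → X), StrictMono φ ∧
      (∀ t ∈ Icc (0:ℝ) T,
        Tendsto (fun j => U (φ j) ⌈t / (T / 2 ^ (φ j))⌉₊) atTop (𝓝 (u t))) ∧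
      (∀ s ∈ Icc (0:ℝ) T, ∀ r ∈ Icc (0:ℝ) T,
        dist (u s) (u r) ≤
          Real.sqrt (2 * (E x0 0
              - sInf {e : ℝ | ∃ x, ∃ t ∈ Icc (0:ℝ) T, e = E x t}
              + ∫ ρ in (0:ℝ)..T, g ρ))
            * Real.sqrt |r - s|) := by
  set C := E x0 0 - sInf {e : ℝ | ∃ x, ∃ t ∈ Icc (0:ℝ) T, e = E x t} + ∫ ρ in (0:ℝ)..T, g ρ
    with hC
  have hg : IntervalIntegrable g volume 0 T := by
    rw [intervalIntegrable_iff_integrableOn_Icc_of_le hT.le]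
    exact hgint
  have hbdd := bddBelow_energy (hlsc 0 ⟨le_rfl, hT.le⟩) hg0 hg hosc
  have hτ : ∀ n : ℕ, 0 < T / 2 ^ n := fun n => by positivity
  have hNτ : ∀ n : ℕ, ((2 ^ n : ℕ) : ℝ) * (T / 2 ^ n) = T := fun n => by
    push_cast
    field_simp
  have hsum : ∀ n, ∑ k ∈ Finset.range (2 ^ n), dist (U n k) (U n (k + 1)) ^ 2 ≤
      2 * (T / 2 ^ n) * C := by
    intro n
    have h1 := sum_dist_sq_div_add_energy_le (hτ n).le hg hosc (hNτ n).le (V := U n) (by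
      intro k hk
      simpa [dist_comm] using hUmin n (k + 1) (by omega) hk (U n k))
    rw [hNτ, hU0, ← Finset.sum_div] at h1
    have h2 := csInf_le hbdd ⟨U n (2 ^ n), T, ⟨hT.le, le_rfl⟩, rfl⟩
    have h3 := hτ n
    rw [mul_comm, ← div_le_iff₀ (by positivity)]
    linarith
  have hC0 : 0 ≤ C := by
    have h1 := (Finset.sum_nonneg fun k _ => sq_nonneg (dist (U 0 k) (U 0 (k + 1)))).trans (hsum 0)
    exact nonneg_of_mul_nonneg_right h1 (by positivity)
  have hceil : ∀ n, ∀ t ≤ T, ⌈t / (T / 2 ^ n)⌉₊ ≤ 2 ^ n := by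
    intro n t ht
    rw [Nat.ceil_le, div_le_iff₀ (hτ n), hNτ]
    exact ht
  have hstep : ∀ n, ∀ s t : ℝ, 0 ≤ s → s ≤ t → t ≤ T →
      dist (U n ⌈s / (T / 2 ^ n)⌉₊) (U n ⌈t / (T / 2 ^ n)⌉₊) ≤
        √(2 * C) * √(t - s + T / 2 ^ n) := by
    intro n s t hs hst ht
    have h1 := dist_sq_le_mul_of_sum_dist_sq_le (hsum n)
      (Nat.ceil_mono (div_le_div_of_nonneg_right hst (hτ n).le)) (hceil n t ht)
    have h2 := mul_le_mul_of_nonneg_left (ceil_div_sub_ceil_div_mul_le (s := s) (hτ n)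
      (hs.trans hst)) (mul_nonneg zero_le_two hC0)
    rw [← Real.sqrt_mul (by positivity)]
    exact Real.le_sqrt_of_sq_le (by linarith)
  obtain ⟨φ, u, hφ, hu, hmod⟩ := exists_subseq_tendsto_of_asymptotic_modulus
    (fun n (t : Icc (0:ℝ) T) => U n ⌈(t : ℝ) / (T / 2 ^ n)⌉₊) (fun x => √(2 * C) * √x)
    (by fun_prop) (by simp) (fun n => T / 2 ^ n)
    (tendsto_const_nhds.div_atTop (tendsto_pow_atTop_atTop_of_one_lt one_lt_two)) (by
      intro n s t
      rw [Subtype.dist_eq, Real.dist_eq]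
      rcases le_total (s : ℝ) t with h | h
      · rw [abs_sub_comm, abs_of_nonneg (sub_nonneg.2 h)]
        exact hstep n s t s.2.1 h t.2.2
      · rw [abs_of_nonneg (sub_nonneg.2 h), dist_comm]
        exact hstep n t s t.2.1 h s.2.2)
  refine ⟨φ, IccExtend hT.le u, hφ, fun t ht => ?_, fun s hs r hr => ?_⟩
  · rw [IccExtend_of_mem _ _ ht]
    exact hu ⟨t, ht⟩
  · rw [IccExtend_of_mem _ _ hs, IccExtend_of_mem _ _ hr, abs_sub_comm]
    exact hmod ⟨s, hs⟩ ⟨r, hr⟩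
end

section
/- Let d ≥ 2, α ≥ 1, T > 0, and let 𝒦 satisfy (K1)–(K3). Let (Θ_t)_{t∈[0,T]} be a narrowly continuous family of Borel probability measures on ℝ^α, each supported in a fixed compact set Q, which is a weak solution of the Fokker–Planck equation with drift f and diffusion G = (1/2)·g·gᵀ, where ∫₀^T sup_{θ∈Q} ‖f(θ, t)‖ dt < ∞ and ∫₀^T sup_{θ∈Q} ‖g(θ, t)‖² dt < ∞. Then for every Borel probability measure u⁰ on S^{d−1} there exists a narrowly continuous curve u : [0, T] → 𝒫(S^{d−1}) with u_0 = u⁰, absolutely continuous with square-integrable metric speed with respect to W₂, such that for every smooth φ : ℝ^d × ℝ → ℝ whose support in the time variable is a compact subset of (0, T): ∫₀^T ∫_{S^{d−1}} [ ∂_tφ(x, t) − ⟨ P_x^⊥(∇_xφ(x, t)), ∫_{ℝ^α} 𝒟𝒦[u_t](x, θ) dΘ_t(θ) ⟩ ] du_t(x) dt = 0; that is, u is a weak solution of the continuity equation ∂_t u_t = div_{S^{d−1}}( u_t · ∫_{ℝ^α} 𝒟𝒦[u_t](·, θ) dΘ_t(θ) ). -/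
open MeasureTheory Filter Topology Set Matrix
open scoped RealInnerProductSpace

noncomputable section

abbrev Ed (n : ℕ) := EuclideanSpace ℝ (Fin n)

/-- The unit sphere `S^{d−1}` in `ℝ^d`. -/
def Sph (d : ℕ) : Set (Ed d) := {x | ‖x‖ = 1}

/-- Tangential projection `P_x^⊥ y = y − ⟨y, x⟩ x`. -/
def Pperp {d : ℕ} (x y : Ed d) : Ed d := y - ⟪y, x⟫ • x

/-- Wasserstein-2 distance, via couplings. -/
def W2 {d : ℕ} (μ ν : Measure (Ed d)) : ℝ :=
  Real.sqrt (sInf {r : ℝ | ∃ γ : Measure (Ed d × Ed d), IsProbabilityMeasure γ ∧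
    γ.map Prod.fst = μ ∧ γ.map Prod.snd = ν ∧ r = ∫ p, ‖p.1 - p.2‖ ^ 2 ∂γ})

/-- Narrow continuity of a measure-valued curve on a set of times. -/
def NarrowlyContinuousOn {X : Type*} [TopologicalSpace X] [MeasurableSpace X]
    (μ : ℝ → Measure X) (s : Set ℝ) : Prop :=
  ∀ φ : BoundedContinuousFunction X ℝ, ContinuousOn (fun t => ∫ x, φ x ∂(μ t)) s

/-- Absolute continuity with square-integrable metric speed on `[0,T]` w.r.t. `W₂`. -/
def AC2 {d : ℕ} (T : ℝ) (u : ℝ → Measure (Ed d)) : Prop :=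
  ∃ h : ℝ → ℝ, (∀ t, 0 ≤ h t) ∧ IntegrableOn (fun t => h t ^ 2) (Icc 0 T) ∧
    ∀ s r : ℝ, 0 ≤ s → s ≤ r → r ≤ T → W2 (u s) (u r) ≤ ∫ ρ in s..r, h ρ

/-- `𝒟𝒦[μ](x,θ) = ∫ P_x^⊥(∇_x𝒦(x,y,θ)) dμ(y)`. -/
def DKer {d α : ℕ} (Kgrad : Ed d → Ed d → Ed α → Ed d) (μ : Measure (Ed d))
    (x : Ed d) (θ : Ed α) : Ed d := ∫ y, Pperp x (Kgrad x y θ) ∂μ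

/-- Weak Fokker–Planck equation for the weight distribution `Θ_t`, with drift `f`
and diffusion `G = ½ g gᵀ`, tested against smooth functions compactly supported
in time in `(0,T)`. -/
def WeakFP {α ξ : ℕ} (T : ℝ) (f : Ed α → ℝ → Ed α)
    (g : Ed α → ℝ → Matrix (Fin α) (Fin ξ) ℝ) (Θ : ℝ → Measure (Ed α)) : Prop :=
  ∀ ψ : Ed α → ℝ → ℝ,
    ContDiff ℝ (⊤ : ℕ∞) (fun p : Ed α × ℝ => ψ p.1 p.2) →
    HasCompactSupport (fun p : Ed α × ℝ => ψ p.1 p.2) →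
    (∃ Kt : Set ℝ, IsCompact Kt ∧ Kt ⊆ Ioo 0 T ∧ ∀ θ t, t ∉ Kt → ψ θ t = 0) →
    ∫ t in (0:ℝ)..T, (∫ θ,
      (deriv (fun s => ψ θ s) t
        + ⟪gradient (fun θ' => ψ θ' t) θ, f θ t⟫
        + ∑ i, ∑ j,
            (fderiv ℝ (fun θ'' => fderiv ℝ (fun θ' => ψ θ' t) θ''
                (EuclideanSpace.single j 1)) θ (EuclideanSpace.single i 1))
              * ((1 / 2 : ℝ) * (g θ t * (g θ t)ᵀ) i j)) ∂(Θ t)) = 0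

/-- `u` is a weak solution of the continuity equation
`∂_t u = div_{S^{d−1}} ( u · ∫ 𝒟𝒦[u] dΘ_t )` (unnormalized attention). -/
def WeakContinuityEq {d α : ℕ} (T : ℝ) (Kgrad : Ed d → Ed d → Ed α → Ed d)
    (Θ : ℝ → Measure (Ed α)) (u : ℝ → Measure (Ed d)) : Prop :=
  ∀ φ : Ed d → ℝ → ℝ,
    ContDiff ℝ (⊤ : ℕ∞) (fun p : Ed d × ℝ => φ p.1 p.2) →
    (∃ Kt : Set ℝ, IsCompact Kt ∧ Kt ⊆ Ioo 0 T ∧ ∀ x t, t ∉ Kt → φ x t = 0) →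
    ∫ t in (0:ℝ)..T, (∫ x,
      (deriv (fun s => φ x s) t
        - ⟪Pperp x (gradient (fun y => φ y t) x),
            ∫ θ, DKer Kgrad (u t) x θ ∂(Θ t)⟫) ∂(u t)) = 0

section RadialExtension

variable {E F : Type*} [NormedAddCommGroup E] [NormedSpace ℝ E]
  [NormedAddCommGroup F] [NormedSpace ℝ F]

/-- Extension of a function on the unit sphere to the whole space, homogeneous of degree one
inside the unit ball and of degree zero outside. -/
def radialExt (f : E → F) (x : E) : F := (min ‖x‖ 1) • f (‖x‖⁻¹ • x)

lemma radialExt_of_norm_eq_one (f : E → F) {x : E} (hx : ‖x‖ = 1) : radialExt f x = f x := by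
  simp [radialExt, hx]

lemma radialExt_zero (f : E → F) : radialExt f 0 = 0 := by
  simp [radialExt]

lemma norm_normalize {x : E} (hx : x ≠ 0) : ‖‖x‖⁻¹ • x‖ = 1 := by
  rw [norm_smul, norm_inv, norm_norm, inv_mul_cancel₀ (norm_ne_zero_iff.2 hx)]

lemma norm_radialExt_le {f : E → F} {M : ℝ} (hf : ∀ x, ‖x‖ = 1 → ‖f x‖ ≤ M) (x : E) :
    ‖radialExt f x‖ ≤ min ‖x‖ 1 * M := by
  rcases eq_or_ne x 0 with rfl | hx
  · simp [radialExt]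
  · have h0 : 0 ≤ min ‖x‖ 1 := by positivity
    rw [radialExt, norm_smul, Real.norm_of_nonneg h0]
    exact mul_le_mul_of_nonneg_left (hf _ (norm_normalize hx)) h0

lemma norm_radialExt_sub_le {f : E → F} {M L : ℝ} (hM : 0 ≤ M) (hL : 0 ≤ L)
    (hf : ∀ x, ‖x‖ = 1 → ‖f x‖ ≤ M)
    (hfL : ∀ x y, ‖x‖ = 1 → ‖y‖ = 1 → ‖f x - f y‖ ≤ L * ‖x - y‖) (x y : E) :
    ‖radialExt f x - radialExt f y‖ ≤ (M + 2 * L) * ‖x - y‖ := by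
  have h0 : 0 ≤ L * ‖x - y‖ := by positivity
  rcases eq_or_ne x 0 with rfl | hx
  · have h1 := norm_radialExt_le hf y
    have h2 : min ‖y‖ 1 * M ≤ ‖y‖ * M := mul_le_mul_of_nonneg_right (min_le_left _ _) hM
    simp only [radialExt_zero, zero_sub, norm_neg] at *
    nlinarith
  rcases eq_or_ne y 0 with rfl | hy
  · have h1 := norm_radialExt_le hf x
    have h2 : min ‖x‖ 1 * M ≤ ‖x‖ * M := mul_le_mul_of_nonneg_right (min_le_left _ _) hM
    simp only [radialExt_zero, sub_zero] at *
    nlinarith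
  set p := ‖x‖⁻¹ • x with hp
  set q := ‖y‖⁻¹ • y with hq
  have hxp : x = ‖x‖ • p := by
    rw [hp, smul_smul, mul_inv_cancel₀ (norm_ne_zero_iff.2 hx), one_smul]
  have hyq : y = ‖y‖ • q := by
    rw [hq, smul_smul, mul_inv_cancel₀ (norm_ne_zero_iff.2 hy), one_smul]
  have hp1 : ‖p‖ = 1 := norm_normalize hx
  have hq1 : ‖q‖ = 1 := norm_normalize hy
  have key : ‖y‖ * ‖p - q‖ ≤ 2 * ‖x - y‖ := by
    have e : ‖y‖ • (p - q) = (‖y‖ - ‖x‖) • p + (x - y) := by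
      conv_rhs => rw [sub_smul, ← hxp]
      rw [smul_sub, ← hyq]; abel
    calc ‖y‖ * ‖p - q‖ = ‖‖y‖ • (p - q)‖ := by rw [norm_smul, norm_norm]
      _ ≤ |‖y‖ - ‖x‖| * ‖p‖ + ‖x - y‖ := by
        rw [e]; refine (norm_add_le _ _).trans ?_; rw [norm_smul, Real.norm_eq_abs]
      _ ≤ ‖x - y‖ * 1 + ‖x - y‖ := by
        rw [hp1]; gcongr; rw [norm_sub_rev x y]; exact abs_norm_sub_norm_le y x
      _ = _ := by ring
  have hm : |min ‖x‖ 1 - min ‖y‖ 1| ≤ ‖x - y‖ :=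
    (abs_min_sub_min_le_max _ _ _ _).trans (by simpa using abs_norm_sub_norm_le x y)
  have hm0 : 0 ≤ min ‖y‖ 1 := by positivity
  have e : radialExt f x - radialExt f y
      = (min ‖x‖ 1 - min ‖y‖ 1) • f p + (min ‖y‖ 1) • (f p - f q) := by
    simp only [radialExt, ← hp, ← hq, sub_smul, smul_sub]; abel
  rw [e]
  refine (norm_add_le _ _).trans ?_
  rw [norm_smul, norm_smul, Real.norm_eq_abs, Real.norm_of_nonneg hm0]
  have h1 : |min ‖x‖ 1 - min ‖y‖ 1| * ‖f p‖ ≤ ‖x - y‖ * M :=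
    mul_le_mul hm (hf p hp1) (norm_nonneg _) (norm_nonneg _)
  have h2 : min ‖y‖ 1 * ‖f p - f q‖ ≤ ‖y‖ * (L * ‖p - q‖) :=
    mul_le_mul (min_le_left _ _) (hfL p q hp1 hq1) (norm_nonneg _) (norm_nonneg _)
  nlinarith

end RadialExtension

section Projection

variable {d : ℕ}

lemma inner_Pperp_self {x : Ed d} (hx : ‖x‖ = 1) (w : Ed d) : ⟪Pperp x w, x⟫ = 0 := by
  simp [Pperp, inner_sub_left, inner_smul_left, hx]

lemma inner_Pperp_left (x w v : Ed d) : ⟪Pperp x w, v⟫ = ⟪w, Pperp x v⟫ := by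
  simp only [Pperp, inner_sub_left, inner_sub_right, inner_smul_left, inner_smul_right,
    RCLike.conj_to_real, real_inner_comm]
  ring

lemma Pperp_of_inner_eq_zero {x w : Ed d} (h : ⟪w, x⟫ = 0) : Pperp x w = w := by
  simp [Pperp, h]

lemma norm_Pperp_le {x : Ed d} (hx : ‖x‖ = 1) (w : Ed d) : ‖Pperp x w‖ ≤ 2 * ‖w‖ := by
  have h := abs_real_inner_le_norm w x
  refine (norm_sub_le _ _).trans ?_
  rw [norm_smul, Real.norm_eq_abs]
  rw [hx] at *
  linarith

lemma norm_Pperp_sub_le {x x' : Ed d} (hx : ‖x‖ = 1) (hx' : ‖x'‖ = 1) (w w' : Ed d) :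
    ‖Pperp x w - Pperp x' w'‖ ≤ 2 * ‖w - w'‖ + 2 * ‖w'‖ * ‖x - x'‖ := by
  have e : Pperp x w - Pperp x' w'
      = Pperp x (w - w') - (⟪w', x - x'⟫ • x + ⟪w', x'⟫ • (x - x')) := by
    simp only [Pperp, inner_sub_left, inner_sub_right, sub_smul, smul_sub]; abel
  rw [e]
  refine (norm_sub_le _ _).trans ?_
  have h1 := norm_Pperp_le hx (w - w')
  have h2 := abs_real_inner_le_norm w' (x - x')
  have h3 := abs_real_inner_le_norm w' x'
  have h4 := norm_add_le (⟪w', x - x'⟫ • x) (⟪w', x'⟫ • (x - x'))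
  rw [norm_smul, norm_smul, Real.norm_eq_abs, Real.norm_eq_abs, hx] at h4
  rw [hx'] at h3
  have h5 : |⟪w', x'⟫| * ‖x - x'‖ ≤ ‖w'‖ * 1 * ‖x - x'‖ := by gcongr
  linarith

end Projection

section ParameterContinuity

variable {d α : ℕ}

lemma norm_cos_smul_add_sin_smul {x v : Ed d} (hx : ‖x‖ = 1) (hv : ‖v‖ = 1) (hxv : ⟪v, x⟫ = 0)
    (s : ℝ) : ‖Real.cos s • x + Real.sin s • v‖ = 1 := by
  have h : ‖Real.cos s • x + Real.sin s • v‖ ^ 2 = 1 := by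
    rw [norm_add_sq_real, norm_smul, norm_smul, inner_smul_left, inner_smul_right,
      real_inner_comm, hxv, hx, hv]
    simp [sq_abs]
  nlinarith [norm_nonneg (Real.cos s • x + Real.sin s • v)]

/-- A family of functions whose gradients are uniformly bounded and Lipschitz on the sphere and
which depends continuously on a parameter has tangential derivatives that are continuous in the
parameter. -/
lemma continuous_inner_grad_of_norm_eq_one {k : Ed d → Ed α → ℝ} {kgrad : Ed d → Ed α → Ed d}
    {B L : ℝ} (hgrad : ∀ θ x, HasGradientAt (fun x' => k x' θ) (kgrad x θ) x)
    (hB : ∀ x, ‖x‖ = 1 → ∀ θ, ‖kgrad x θ‖ ≤ B)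
    (hL : ∀ x x', ‖x‖ = 1 → ‖x'‖ = 1 → ∀ θ, ‖kgrad x θ - kgrad x' θ‖ ≤ L * ‖x - x'‖)
    (hk : ∀ x, Continuous (k x)) {x v : Ed d} (hx : ‖x‖ = 1) (hv : ‖v‖ = 1) (hxv : ⟪v, x⟫ = 0) :
    Continuous fun θ => ⟪kgrad x θ, v⟫ := by
  set c : ℝ → Ed d := fun s => Real.cos s • x + Real.sin s • v with hc
  set c' : ℝ → Ed d := fun s => -Real.sin s • x + Real.cos s • v with hc'
  have hc1 : ∀ s, ‖c s‖ = 1 := norm_cos_smul_add_sin_smul hx hv hxv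
  have hc0 : c 0 = x := by simp [hc]
  have hc'0 : c' 0 = v := by simp [hc']
  have hderiv : ∀ s, HasDerivAt c (c' s) s := fun s =>
    ((Real.hasDerivAt_cos s).smul_const x).add ((Real.hasDerivAt_sin s).smul_const v)
  have hsin : ∀ s, |Real.sin s| ≤ |s| := fun s => by
    simpa using Real.abs_sin_le_abs (x := s)
  have hcos : ∀ s, |Real.cos s - 1| ≤ |s| := fun s => by
    simpa using Real.abs_cos_sub_cos_le s 0
  have hcx : ∀ s, ‖c s - x‖ ≤ 2 * |s| := fun s => by
    have e : c s - x = (Real.cos s - 1) • x + Real.sin s • v := by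
      simp only [hc, sub_smul, one_smul]; abel
    rw [e]
    refine (norm_add_le _ _).trans ?_
    rw [norm_smul, norm_smul, hx, hv, Real.norm_eq_abs, Real.norm_eq_abs]
    linarith [hsin s, hcos s]
  have hcv : ∀ s, ‖c' s - v‖ ≤ 2 * |s| := fun s => by
    have e : c' s - v = (-Real.sin s) • x + (Real.cos s - 1) • v := by
      simp only [hc', sub_smul, one_smul]; abel
    rw [e]
    refine (norm_add_le _ _).trans ?_
    rw [norm_smul, norm_smul, hx, hv, Real.norm_eq_abs, Real.norm_eq_abs, abs_neg]
    linarith [hsin s, hcos s]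
  have hkd : ∀ θ s, HasDerivAt (fun s => k (c s) θ) ⟪kgrad (c s) θ, c' s⟫ s := fun θ s => by
    have := (hgrad θ (c s)).hasFDerivAt.comp_hasDerivAt s (hderiv s)
    simpa using! this
  set C : ℝ := 2 * |L| + 2 * |B| with hC
  have hbound : ∀ θ s, |⟪kgrad (c s) θ, c' s⟫ - ⟪kgrad x θ, v⟫| ≤ C * |s| := fun θ s => by
    have e : ⟪kgrad (c s) θ, c' s⟫ - ⟪kgrad x θ, v⟫
        = ⟪kgrad (c s) θ, c' s - v⟫ + ⟪kgrad (c s) θ - kgrad x θ, v⟫ := by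
      rw [inner_sub_right, inner_sub_left]; ring
    rw [e]
    refine (abs_add_le _ _).trans ?_
    have h1 := abs_real_inner_le_norm (kgrad (c s) θ) (c' s - v)
    have h2 := abs_real_inner_le_norm (kgrad (c s) θ - kgrad x θ) v
    have h3 : ‖kgrad (c s) θ‖ * ‖c' s - v‖ ≤ |B| * (2 * |s|) :=
      mul_le_mul ((hB _ (hc1 s) θ).trans (le_abs_self B)) (hcv s) (norm_nonneg _) (abs_nonneg _)
    have h4 : ‖kgrad (c s) θ - kgrad x θ‖ ≤ |L| * (2 * |s|) :=
      (hL _ _ (hc1 s) hx θ).trans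
        (mul_le_mul (le_abs_self L) (hcx s) (norm_nonneg _) (abs_nonneg _))
    rw [hv, mul_one] at h2
    rw [hC]; linarith
  have hC0 : 0 ≤ C := by positivity
  have hest : ∀ s, 0 < s → ∀ θ, |s⁻¹ * (k (c s) θ - k x θ) - ⟪kgrad x θ, v⟫| ≤ C * s := by
    intro s hs θ
    have h := (convex_Icc (0:ℝ) s).norm_image_sub_le_of_norm_hasDerivWithin_le
      (f := fun r => k (c r) θ - r * ⟪kgrad x θ, v⟫) (C := C * s)
      (f' := fun r => ⟪kgrad (c r) θ, c' r⟫ - 1 * ⟪kgrad x θ, v⟫)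
      (fun r _ => ((hkd θ r).sub ((hasDerivAt_id r).mul_const _)).hasDerivWithinAt)
      (fun r hr => by
        rw [one_mul, Real.norm_eq_abs]
        refine (hbound θ r).trans ?_
        rw [abs_of_nonneg hr.1]
        exact mul_le_mul_of_nonneg_left hr.2 hC0)
      (left_mem_Icc.2 hs.le) (right_mem_Icc.2 hs.le)
    simp only [hc0, zero_mul, sub_zero, Real.norm_eq_abs, abs_of_pos hs] at h
    have e : s⁻¹ * (k (c s) θ - k x θ) - ⟪kgrad x θ, v⟫
        = s⁻¹ * (k (c s) θ - s * ⟪kgrad x θ, v⟫ - k x θ) := by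
      field_simp; ring
    rw [e, abs_mul, abs_of_pos (inv_pos.2 hs)]
    calc _ ≤ s⁻¹ * (C * s * s) := by gcongr
      _ = C * s := by field_simp
  have hunif : TendstoUniformly (fun (s : ℝ) θ => s⁻¹ * (k (c s) θ - k x θ))
      (fun θ => ⟪kgrad x θ, v⟫) (𝓝[>] 0) := by
    rw [Metric.tendstoUniformly_iff]
    intro ε hε
    have hlim : Tendsto (fun s : ℝ => C * s) (𝓝[>] 0) (𝓝 0) := by
      have : Tendsto (fun s : ℝ => C * s) (𝓝 0) (𝓝 (C * 0)) :=
        (continuous_const.mul continuous_id).tendsto 0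
      rw [mul_zero] at this
      exact this.mono_left nhdsWithin_le_nhds
    filter_upwards [hlim.eventually_lt_const hε, self_mem_nhdsWithin] with s h1 h2 θ
    rw [dist_comm, Real.dist_eq]
    exact (hest s h2 θ).trans_lt h1
  exact hunif.continuous (Frequently.of_forall fun s =>
    continuous_const.mul ((hk _).sub (hk _)))

lemma continuous_Pperp_grad {k : Ed d → Ed α → ℝ} {kgrad : Ed d → Ed α → Ed d}
    {B L : ℝ} (hgrad : ∀ θ x, HasGradientAt (fun x' => k x' θ) (kgrad x θ) x)
    (hB : ∀ x, ‖x‖ = 1 → ∀ θ, ‖kgrad x θ‖ ≤ B)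
    (hL : ∀ x x', ‖x‖ = 1 → ‖x'‖ = 1 → ∀ θ, ‖kgrad x θ - kgrad x' θ‖ ≤ L * ‖x - x'‖)
    (hk : ∀ x, Continuous (k x)) {x : Ed d} (hx : ‖x‖ = 1) :
    Continuous fun θ => Pperp x (kgrad x θ) := by
  have hv : ∀ v : Ed d, ⟪v, x⟫ = 0 → Continuous fun θ => ⟪kgrad x θ, v⟫ := by
    intro v hxv
    rcases eq_or_ne v 0 with rfl | hv0
    · simpa using continuous_const
    have h := continuous_inner_grad_of_norm_eq_one hgrad hB hL hk hx (norm_normalize hv0)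
      (by rw [inner_smul_left, hxv, mul_zero])
    have e : (fun θ => ⟪kgrad x θ, v⟫) = fun θ => ‖v‖ * ⟪kgrad x θ, ‖v‖⁻¹ • v⟫ := by
      funext θ
      rw [inner_smul_right, mul_inv_cancel_left₀ (norm_ne_zero_iff.2 hv0)]
    rw [e]
    exact continuous_const.mul h
  have e : (fun θ => Pperp x (kgrad x θ)) = fun θ => ∑ i,
      ⟪kgrad x θ, Pperp x (EuclideanSpace.basisFun (Fin d) ℝ i)⟫
        • EuclideanSpace.basisFun (Fin d) ℝ i := by
    funext θ
    conv_lhs => rw [← (EuclideanSpace.basisFun (Fin d) ℝ).sum_repr' (Pperp x (kgrad x θ))]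
    refine Finset.sum_congr rfl fun i _ => ?_
    rw [real_inner_comm, inner_Pperp_left]
  rw [e]
  exact continuous_finsetSum _ fun i _ => (hv _ (inner_Pperp_self hx _)).smul continuous_const

end ParameterContinuity

section InteractionKernel

variable {d α : ℕ}

lemma radialExt_sub {E F : Type*} [NormedAddCommGroup E] [NormedSpace ℝ E]
    [NormedAddCommGroup F] [NormedSpace ℝ F] (f g : E → F) (x : E) :
    radialExt f x - radialExt g x = radialExt (fun z => f z - g z) x := by
  simp [radialExt, smul_sub]

lemma norm_radialExt_le' {E F : Type*} [NormedAddCommGroup E] [NormedSpace ℝ E]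
    [NormedAddCommGroup F] [NormedSpace ℝ F] {f : E → F} {M : ℝ} (hM : 0 ≤ M)
    (hf : ∀ x, ‖x‖ = 1 → ‖f x‖ ≤ M) (x : E) : ‖radialExt f x‖ ≤ M :=
  (norm_radialExt_le hf x).trans (mul_le_of_le_one_left hM (min_le_right _ _))

/-- The tangential gradient `P_x^⊥ (∇_x 𝒦(x, y, θ))`, extended from the sphere to all
`x` and `y`. -/
def tangentKernel (Kgrad : Ed d → Ed d → Ed α → Ed d) (x y : Ed d) (θ : Ed α) : Ed d :=
  radialExt (fun x' => radialExt (fun y' => Pperp x' (Kgrad x' y' θ)) y) x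

variable {Kgrad : Ed d → Ed d → Ed α → Ed d}

lemma tangentKernel_of_norm_eq_one {x y : Ed d} (hx : ‖x‖ = 1) (hy : ‖y‖ = 1) (θ : Ed α) :
    tangentKernel Kgrad x y θ = Pperp x (Kgrad x y θ) := by
  rw [tangentKernel, radialExt_of_norm_eq_one _ hx, radialExt_of_norm_eq_one _ hy]

lemma inner_tangentKernel (x y : Ed d) (θ : Ed α) : ⟪tangentKernel Kgrad x y θ, x⟫ = 0 := by
  rcases eq_or_ne x 0 with rfl | hx
  · simp
  have h := inner_Pperp_self (norm_normalize hx) (Kgrad (‖x‖⁻¹ • x) (‖y‖⁻¹ • y) θ)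
  rw [inner_smul_right, mul_eq_zero] at h
  have h' := h.resolve_left (inv_ne_zero (norm_ne_zero_iff.2 hx))
  simp only [tangentKernel, radialExt, inner_smul_left, h', mul_zero]

variable {B L : ℝ}

lemma norm_tangentKernel_le (hB0 : 0 ≤ B)
    (hB : ∀ x y : Ed d, ‖x‖ = 1 → ‖y‖ = 1 → ∀ θ, ‖Kgrad x y θ‖ ≤ B) (x y : Ed d) (θ : Ed α) :
    ‖tangentKernel Kgrad x y θ‖ ≤ 2 * B :=
  norm_radialExt_le' (by positivity) (fun x' hx' => norm_radialExt_le' (by positivity)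
    (fun y' hy' => (norm_Pperp_le hx' _).trans (by linarith [hB x' y' hx' hy' θ])) y) x

lemma norm_tangentKernel_sub_le (hB0 : 0 ≤ B) (hL0 : 0 ≤ L)
    (hB : ∀ x y : Ed d, ‖x‖ = 1 → ‖y‖ = 1 → ∀ θ, ‖Kgrad x y θ‖ ≤ B)
    (hL : ∀ x x' y y' : Ed d, ‖x‖ = 1 → ‖x'‖ = 1 → ‖y‖ = 1 → ‖y'‖ = 1 →
      ∀ θ, ‖Kgrad x y θ - Kgrad x' y' θ‖ ≤ L * (‖x - x'‖ + ‖y - y'‖))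
    (x x' y y' : Ed d) (θ : Ed α) :
    ‖tangentKernel Kgrad x y θ - tangentKernel Kgrad x' y' θ‖
      ≤ (6 * B + 4 * L) * (‖x - x'‖ + ‖y - y'‖) := by
  have hP : ∀ p q : Ed d, ‖p‖ = 1 → ‖q‖ = 1 → ‖Pperp p (Kgrad p q θ)‖ ≤ 2 * B :=
    fun p q hp hq => (norm_Pperp_le hp _).trans (by linarith [hB p q hp hq θ])
  have h1 : ‖tangentKernel Kgrad x y θ - tangentKernel Kgrad x' y θ‖
      ≤ (2 * B + 2 * (2 * L + 2 * B)) * ‖x - x'‖ := by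
    refine norm_radialExt_sub_le (by positivity) (by positivity)
      (fun p hp => norm_radialExt_le' (by positivity) (fun q hq => hP p q hp hq) y)
      (fun p p' hp hp' => ?_) x x'
    rw [radialExt_sub]
    refine norm_radialExt_le' (by positivity) (fun q hq => ?_) y
    refine (norm_Pperp_sub_le hp hp' _ _).trans ?_
    have h2 := hL p p' q q hp hp' hq hq θ
    have h3 := mul_le_mul_of_nonneg_right (hB p' q hp' hq θ) (norm_nonneg (p - p'))
    rw [sub_self, norm_zero, add_zero] at h2
    linarith
  have h2 : ‖tangentKernel Kgrad x' y θ - tangentKernel Kgrad x' y' θ‖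
      ≤ (2 * B + 2 * (2 * L)) * ‖y - y'‖ := by
    rw [tangentKernel, tangentKernel, radialExt_sub]
    refine norm_radialExt_le' (by positivity) (fun p hp => ?_) x'
    refine norm_radialExt_sub_le (by positivity) (by positivity) (fun q hq => hP p q hp hq)
      (fun q q' hq hq' => ?_) y y'
    refine (norm_Pperp_sub_le hp hp _ _).trans ?_
    have h3 := hL p p q q' hp hp hq hq' θ
    rw [sub_self, norm_zero, zero_add] at h3
    rw [sub_self, norm_zero, mul_zero, add_zero]
    linarith
  have h3 := norm_sub_le_norm_sub_add_norm_sub (tangentKernel Kgrad x y θ)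
    (tangentKernel Kgrad x' y θ) (tangentKernel Kgrad x' y' θ)
  have h4 : 0 ≤ B * ‖y - y'‖ := by positivity
  nlinarith

variable {K : Ed d → Ed d → Ed α → ℝ}

lemma continuous_tangentKernel_param
    (hgrad : ∀ y θ x, HasGradientAt (fun x' => K x' y θ) (Kgrad x y θ) x)
    (hB : ∀ x y : Ed d, ‖x‖ = 1 → ‖y‖ = 1 → ∀ θ, ‖Kgrad x y θ‖ ≤ B)
    (hL : ∀ x x' y y' : Ed d, ‖x‖ = 1 → ‖x'‖ = 1 → ‖y‖ = 1 → ‖y'‖ = 1 →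
      ∀ θ, ‖Kgrad x y θ - Kgrad x' y' θ‖ ≤ L * (‖x - x'‖ + ‖y - y'‖))
    (hK : ∀ x y, Continuous fun θ => K x y θ) (x y : Ed d) :
    Continuous fun θ => tangentKernel Kgrad x y θ := by
  rcases eq_or_ne x 0 with rfl | hx
  · simp [tangentKernel, radialExt, continuous_const]
  rcases eq_or_ne y 0 with rfl | hy
  · simp [tangentKernel, radialExt, continuous_const]
  have hy1 := norm_normalize hy
  have h : Continuous fun θ => Pperp (‖x‖⁻¹ • x) (Kgrad (‖x‖⁻¹ • x) (‖y‖⁻¹ • y) θ) :=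
    continuous_Pperp_grad (k := fun x θ => K x (‖y‖⁻¹ • y) θ)
      (kgrad := fun x θ => Kgrad x (‖y‖⁻¹ • y) θ) (fun θ x => hgrad _ θ x)
      (fun x hx => hB x _ hx hy1)
      (fun x x' hx hx' θ => by simpa using hL x x' _ _ hx hx' hy1 hy1 θ)
      (fun x => hK x _) (norm_normalize hx)
  exact (h.const_smul (min ‖y‖ 1)).const_smul (min ‖x‖ 1)

/-- Vector-valued narrow continuity. -/
lemma NarrowlyContinuousOn.continuousOn_integral {X : Type*} [TopologicalSpace X]
    [MeasurableSpace X] [OpensMeasurableSpace X] {ν : ℝ → Measure X} {s : Set ℝ}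
    (hν : NarrowlyContinuousOn ν s) (hfin : ∀ t ∈ s, IsFiniteMeasure (ν t)) {F : X → Ed d}
    (hF : Continuous F) {C : ℝ} (hC : ∀ θ, ‖F θ‖ ≤ C) :
    ContinuousOn (fun t => ∫ θ, F θ ∂(ν t)) s := by
  have hcomp : ∀ i, ContinuousOn (fun t => (∫ θ, F θ ∂(ν t)) i) s := by
    intro i
    have hi : Continuous fun θ => F θ i := (EuclideanSpace.proj (𝕜 := ℝ) i).continuous.comp hF
    have h := hν (BoundedContinuousFunction.ofNormedAddCommGroup (fun θ => F θ i) hi C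
      fun θ => (PiLp.norm_apply_le (F θ) i).trans (hC θ))
    refine h.congr fun t ht => ?_
    have := hfin t ht
    have hint : Integrable F (ν t) :=
      Integrable.of_bound hF.aestronglyMeasurable C (Eventually.of_forall hC)
    exact ((EuclideanSpace.proj (𝕜 := ℝ) i).integral_comp_comm hint).symm
  have h := (PiLp.continuous_toLp 2 (fun _ : Fin d => ℝ)).comp_continuousOn
    (continuousOn_pi.2 hcomp)
  exact h

end InteractionKernel

section MeanFieldFlow

variable {E : Type*} [NormedAddCommGroup E]

lemma continuous_of_norm_sub_le {W : ℝ → E → E → E} {L : ℝ}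
    (hL : ∀ t x x' y y', ‖W t x y - W t x' y'‖ ≤ L * (‖x - x'‖ + ‖y - y'‖))
    (hcont : ∀ x y, Continuous fun t => W t x y) :
    Continuous fun p : ℝ × (E × E) => W p.1 p.2.1 p.2.2 := by
  refine continuous_prod_of_continuous_lipschitzWith' _ (2 * L.toNNReal) (fun t => ?_)
    (fun p => hcont p.1 p.2)
  refine LipschitzWith.of_dist_le_mul fun p q => ?_
  rw [dist_eq_norm, dist_eq_norm]
  refine (hL t p.1 q.1 p.2 q.2).trans ?_
  have h1 : ‖p.1 - q.1‖ ≤ ‖p - q‖ := norm_fst_le (p - q)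
  have h2 : ‖p.2 - q.2‖ ≤ ‖p - q‖ := norm_snd_le (p - q)
  calc L * (‖p.1 - q.1‖ + ‖p.2 - q.2‖) ≤ (L.toNNReal : ℝ) * (‖p - q‖ + ‖p - q‖) := by
        gcongr; exact Real.le_coe_toNNReal L
    _ = _ := by push_cast; ring

variable [InnerProductSpace ℝ E]

lemma hasDerivWithinAt_eval {X : ℝ → BoundedContinuousFunction E E}
    {Y : BoundedContinuousFunction E E} {s : Set ℝ} {t : ℝ} (h : HasDerivWithinAt X Y s t) (x : E) :
    HasDerivWithinAt (fun t => X t x) (Y x) s t :=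
  (BoundedContinuousFunction.evalCLM (β := E) ℝ x).hasFDerivAt.comp_hasDerivWithinAt t h

/-- The flow of a field tangent to spheres preserves the norm. -/
lemma norm_flow_eq {T : ℝ} {x v : ℝ → E}
    (hx : ∀ t ∈ Icc 0 T, HasDerivWithinAt x (v t) (Icc 0 T) t)
    (horth : ∀ t ∈ Icc 0 T, ⟪v t, x t⟫ = 0) {t : ℝ} (ht : t ∈ Icc 0 T) : ‖x t‖ = ‖x 0‖ := by
  have h := (convex_Icc (0:ℝ) T).norm_image_sub_le_of_norm_hasDerivWithin_le
    (f := fun t => ‖x t‖ ^ 2) (C := 0) (fun t ht => (hx t ht).norm_sq)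
    (fun t ht => by rw [real_inner_comm, horth t ht]; simp)
    (left_mem_Icc.2 (ht.1.trans ht.2)) ht
  rw [zero_mul, norm_le_zero_iff, sub_eq_zero] at h
  exact (sq_eq_sq₀ (norm_nonneg _) (norm_nonneg _)).1 h

variable [FiniteDimensional ℝ E] [MeasurableSpace E] [BorelSpace E]

/-- Global existence of the flow of a mean-field interaction with bounded, Lipschitz
interaction kernel, as a curve in the space of bounded continuous maps. -/
theorem exists_meanField_flow {T : ℝ} (hT : 0 ≤ T) {W : ℝ → E → E → E} {M L : ℝ} (hL0 : 0 ≤ L)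
    (hM : ∀ t x y, ‖W t x y‖ ≤ M)
    (hL : ∀ t x x' y y', ‖W t x y - W t x' y'‖ ≤ L * (‖x - x'‖ + ‖y - y'‖))
    (hcont : ∀ x y, Continuous fun t => W t x y)
    (μ : Measure E) [IsProbabilityMeasure μ] (X₀ : BoundedContinuousFunction E E) :
    ∃ X Y : ℝ → BoundedContinuousFunction E E, X 0 = X₀ ∧ ContinuousOn Y (Icc 0 T) ∧
      (∀ t ∈ Icc 0 T, HasDerivWithinAt X (Y t) (Icc 0 T) t) ∧
      ∀ t x, Y t x = -∫ y, W t (X t x) (X t y) ∂μ := by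
  have hjoint := continuous_of_norm_sub_le hL hcont
  have hM0 : 0 ≤ M := (norm_nonneg _).trans (hM 0 0 0)
  have hint : ∀ t p (X : BoundedContinuousFunction E E),
      Integrable (fun y => W t p (X y)) μ := fun t p X =>
    Integrable.of_bound (Continuous.aestronglyMeasurable
      (hjoint.comp (continuous_const.prodMk (continuous_const.prodMk X.continuous)))) M
      (Eventually.of_forall fun y => hM _ _ _)
  have hex : ∀ t (X : BoundedContinuousFunction E E), ∃ Z : BoundedContinuousFunction E E,
      ∀ x, Z x = -∫ y, W t (X x) (X y) ∂μ := by
    intro t X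
    refine ⟨BoundedContinuousFunction.ofNormedAddCommGroup
      (fun x => -∫ y, W t (X x) (X y) ∂μ) (Continuous.neg ?_) M fun x => ?_, fun x => rfl⟩
    · refine continuous_of_dominated (bound := fun _ => M) (fun x => (hint t _ X).1)
        (fun x => Eventually.of_forall fun y => hM _ _ _) (integrable_const _)
        (Eventually.of_forall fun y => ?_)
      exact hjoint.comp (continuous_const.prodMk (X.continuous.prodMk continuous_const))
    · rw [norm_neg]
      simpa using norm_integral_le_of_norm_le_const (μ := μ) (C := M)
        (Eventually.of_forall fun y => hM t (X x) (X y))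
  choose G hG using hex
  have hGM : ∀ t X, ‖G t X‖ ≤ M := fun t X => by
    refine (BoundedContinuousFunction.norm_le hM0).2 fun x => ?_
    rw [hG, norm_neg]
    simpa using norm_integral_le_of_norm_le_const (μ := μ) (C := M)
      (Eventually.of_forall fun y => hM t (X x) (X y))
  have hsub : ∀ t s (X X' : BoundedContinuousFunction E E) (C : ℝ), 0 ≤ C →
      (∀ x y, ‖W t (X x) (X y) - W s (X' x) (X' y)‖ ≤ C) → ‖G t X - G s X'‖ ≤ C := by
    intro t s X X' C hC h
    refine (BoundedContinuousFunction.norm_le hC).2 fun x => ?_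
    rw [BoundedContinuousFunction.sub_apply, hG, hG, ← neg_sub', norm_neg,
      ← integral_sub (hint _ _ _) (hint _ _ _)]
    simpa using norm_integral_le_of_norm_le_const (μ := μ) (C := C)
      (Eventually.of_forall fun y => h x y)
  have hlip : ∀ t, LipschitzWith (2 * L.toNNReal) (G t) := by
    intro t
    refine LipschitzWith.of_dist_le_mul fun X X' => ?_
    rw [dist_eq_norm, dist_eq_norm]
    refine hsub _ _ _ _ _ (by positivity) fun x y => (hL _ _ _ _ _).trans ?_
    have h : ∀ z, ‖X z - X' z‖ ≤ ‖X - X'‖ := fun z => (X - X').norm_coe_le_norm z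
    calc L * (‖X x - X' x‖ + ‖X y - X' y‖) ≤ L * (‖X - X'‖ + ‖X - X'‖) := by
          gcongr <;> exact h _
      _ = _ := by push_cast; rw [Real.coe_toNNReal _ hL0]; ring
  have hGt : ∀ X, Continuous fun t => G t X := by
    intro X
    rw [continuous_iff_continuousAt]
    intro t
    rw [Metric.continuousAt_iff']
    intro ε hε
    set k : Set (E × E) := Metric.closedBall 0 ‖X‖ ×ˢ Metric.closedBall 0 ‖X‖
    have hk : IsCompact k := (isCompact_closedBall _ _).prod (isCompact_closedBall _ _)
    obtain ⟨v, hv, h⟩ := hk.mem_uniformity_of_prod (f := fun t (p : E × E) => W t p.1 p.2)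
      (s := univ) hjoint.continuousOn (mem_univ t) (Metric.dist_mem_uniformity (half_pos hε))
    rw [nhdsWithin_univ] at hv
    filter_upwards [hv] with s hs
    rw [dist_eq_norm]
    refine (hsub _ _ _ _ (ε / 2) (half_pos hε).le fun x y => ?_).trans_lt (half_lt_self hε)
    have h1 : (X x, X y) ∈ k := by
      simp only [k, mem_prod, mem_closedBall_zero_iff]
      exact ⟨X.norm_coe_le_norm x, X.norm_coe_le_norm y⟩
    have h2 : dist (W t (X x) (X y)) (W s (X x) (X y)) < ε / 2 := by
      rw [dist_comm]; exact h s hs _ h1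
    rw [dist_comm, dist_eq_norm] at h2
    exact h2.le
  have hPL : IsPicardLindelof G (⟨0, left_mem_Icc.2 hT⟩ : Icc 0 T) X₀ (M * T).toNNReal 0
      M.toNNReal (2 * L.toNNReal) :=
    { lipschitzOnWith := fun t _ => (hlip t).lipschitzOnWith
      continuousOn := fun X _ => (hGt X).continuousOn
      norm_le := fun t _ X _ => by rw [Real.coe_toNNReal _ hM0]; exact hGM t X
      mul_max_le := by
        rw [Real.coe_toNNReal _ hM0, Real.coe_toNNReal _ (by positivity)]
        simp [hT] }
  obtain ⟨X, hX0, hX⟩ := hPL.exists_eq_forall_mem_Icc_hasDerivWithinAt₀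
  refine ⟨X, fun t => G t (X t), hX0, ?_, hX, fun t x => hG _ _ _⟩
  have hGjoint : Continuous fun p : ℝ × BoundedContinuousFunction E E => G p.1 p.2 :=
    continuous_prod_of_continuous_lipschitzWith' _ _ hlip hGt
  exact hGjoint.comp_continuousOn
    (continuousOn_id.prodMk fun t ht => (hX t ht).continuousWithinAt)

end MeanFieldFlow

section TransportedTestFunctions

variable {E : Type*} [NormedAddCommGroup E] [InnerProductSpace ℝ E]
  [MeasurableSpace E] [OpensMeasurableSpace E] [SecondCountableTopology E] [ProperSpace E]

lemma integral_fderiv_flow_eq_zero {T : ℝ} (hT : 0 ≤ T)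
    {X Y : ℝ → BoundedContinuousFunction E E} (hY : ContinuousOn Y (Icc 0 T))
    (hX : ∀ t ∈ Icc 0 T, HasDerivWithinAt X (Y t) (Icc 0 T) t)
    (μ : Measure E) [IsProbabilityMeasure μ] {Φ : E × ℝ → ℝ} (hΦ : ContDiff ℝ 1 Φ)
    (h0 : ∀ x, Φ (x, 0) = 0) (h1 : ∀ x, Φ (x, T) = 0) :
    ∫ t in (0:ℝ)..T, ∫ x, fderiv ℝ Φ (X t x, t) (Y t x, 1) ∂μ = 0 := by
  set τ : ℝ → ℝ := fun t => (projIcc 0 T hT t : ℝ) with hτdef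
  have hτ : Continuous τ := continuous_subtype_val.comp continuous_projIcc
  have hτm : ∀ t, τ t ∈ Icc 0 T := fun t => (projIcc 0 T hT t).2
  have hτe : ∀ t ∈ Icc 0 T, τ t = t := fun t ht => by simp [hτdef, projIcc_of_mem hT ht]
  have hXc : ContinuousOn X (Icc 0 T) := fun t ht => (hX t ht).continuousWithinAt
  have hXτ : Continuous fun t => X (τ t) := hXc.comp_continuous hτ hτm
  have hYτ : Continuous fun t => Y (τ t) := hY.comp_continuous hτ hτm
  obtain ⟨R, hR⟩ := isCompact_Icc.exists_bound_of_continuousOn hXc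
  obtain ⟨S, hS⟩ := isCompact_Icc.exists_bound_of_continuousOn hY
  have hDc : Continuous fun q : (E × ℝ) × E => fderiv ℝ Φ q.1 (q.2, 1) :=
    ((hΦ.continuous_fderiv one_ne_zero).comp continuous_fst).clm_apply
      (continuous_snd.prodMk continuous_const)
  obtain ⟨C, hC⟩ := (((isCompact_closedBall (0 : E) R).prod (isCompact_Icc (a := 0) (b := T))).prod
    (isCompact_closedBall (0 : E) S)).exists_bound_of_continuousOn hDc.continuousOn
  set H : ℝ → E → ℝ := fun t x => fderiv ℝ Φ (X (τ t) x, τ t) (Y (τ t) x, 1) with hH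
  have hHc : Continuous fun p : ℝ × E => H p.1 p.2 := by
    have hXe : Continuous fun p : ℝ × E => X (τ p.1) p.2 :=
      (hXτ.comp continuous_fst).eval continuous_snd
    have hYe : Continuous fun p : ℝ × E => Y (τ p.1) p.2 :=
      (hYτ.comp continuous_fst).eval continuous_snd
    exact hDc.comp ((hXe.prodMk (hτ.comp continuous_fst)).prodMk hYe)
  have hHb : ∀ t x, ‖H t x‖ ≤ C := fun t x => by
    refine hC ((X (τ t) x, τ t), Y (τ t) x) ⟨⟨?_, hτm t⟩, ?_⟩
    · simpa using! ((X (τ t)).norm_coe_le_norm x).trans (hR _ (hτm t))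
    · simpa using! ((Y (τ t)).norm_coe_le_norm x).trans (hS _ (hτm t))
  have hint : Integrable (Function.uncurry H) ((volume.restrict (uIoc 0 T)).prod μ) := by
    rw [uIoc_of_le hT]
    exact Integrable.of_bound hHc.aestronglyMeasurable C (Eventually.of_forall fun p => hHb _ _)
  have e : ∫ t in (0:ℝ)..T, ∫ x, fderiv ℝ Φ (X t x, t) (Y t x, 1) ∂μ
      = ∫ t in (0:ℝ)..T, ∫ x, H t x ∂μ := by
    refine intervalIntegral.integral_congr fun t ht => ?_
    rw [uIcc_of_le hT] at ht
    simp only [hH, hτe t ht]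
  rw [e, intervalIntegral_integral_swap hint]
  refine integral_eq_zero_of_ae (Eventually.of_forall fun x => ?_)
  have hd : ∀ t ∈ Icc 0 T, HasDerivWithinAt (fun t => Φ (X t x, t)) (H t x) (Icc 0 T) t := by
    intro t ht
    have hcurve : HasDerivWithinAt (fun t => (X t x, t)) (Y t x, 1) (Icc 0 T) t :=
      (hasDerivWithinAt_eval (hX t ht) x).prodMk (hasDerivWithinAt_id t _)
    have hΦt : HasFDerivAt Φ (fderiv ℝ Φ (X t x, t)) (X t x, t) :=
      ((hΦ.differentiable one_ne_zero).differentiableAt (x := (X t x, t))).hasFDerivAt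
    simpa only [hH, hτe t ht] using!
      HasFDerivAt.comp_hasDerivWithinAt (f := fun t => (X t x, t)) t hΦt hcurve
  have hftc := intervalIntegral.integral_eq_sub_of_hasDerivAt_of_le hT
    (f := fun t => Φ (X t x, t)) (f' := fun t => H t x)
    (fun t ht => (hd t ht).continuousWithinAt)
    (fun t ht => (hd t (Ioo_subset_Icc_self ht)).hasDerivAt (Icc_mem_nhds ht.1 ht.2))
    ((hHc.comp (continuous_id.prodMk continuous_const)).intervalIntegrable _ _)
  simpa [h0, h1] using hftc

end TransportedTestFunctions

section Wasserstein

variable {d : ℕ}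

lemma W2_map_le (μ : Measure (Ed d)) [IsProbabilityMeasure μ]
    {X X' : BoundedContinuousFunction (Ed d) (Ed d)} {C : ℝ} (hC : ‖X - X'‖ ≤ C) :
    W2 (μ.map X) (μ.map X') ≤ C := by
  have hC0 : 0 ≤ C := (norm_nonneg _).trans hC
  have hm : Measurable fun x => (X x, X' x) :=
    (X.continuous.prodMk X'.continuous).measurable
  have hb : ∀ x, ‖X x - X' x‖ ≤ C := fun x => ((X - X').norm_coe_le_norm x).trans hC
  refine Real.sqrt_le_iff.2 ⟨hC0, ?_⟩
  have hle : ∫ p, ‖p.1 - p.2‖ ^ 2 ∂(μ.map fun x => (X x, X' x)) ≤ C ^ 2 := by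
    rw [integral_map hm.aemeasurable (Continuous.aestronglyMeasurable (by fun_prop))]
    have h := norm_integral_le_of_norm_le_const (μ := μ) (f := fun x => ‖X x - X' x‖ ^ 2)
      (C := C ^ 2) (Eventually.of_forall fun x => by
        rw [norm_pow, norm_norm]; exact pow_le_pow_left₀ (norm_nonneg _) (hb x) 2)
    simpa using (le_abs_self _).trans h
  have hprob := Measure.isProbabilityMeasure_map (μ := μ) hm.aemeasurable
  refine le_trans (csInf_le ⟨0, ?_⟩ (a := ∫ p, ‖p.1 - p.2‖ ^ 2 ∂(μ.map fun x => (X x, X' x)))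
    ⟨μ.map fun x => (X x, X' x), hprob, ?_, ?_, rfl⟩) hle
  · rintro r ⟨γ, -, -, -, rfl⟩
    exact integral_nonneg fun p => by positivity
  · rw [Measure.map_map measurable_fst hm]; rfl
  · rw [Measure.map_map measurable_snd hm]; rfl

end Wasserstein

section AveragedKernel

variable {d α : ℕ}

lemma integral_DKer_eq {Kgrad : Ed d → Ed d → Ed α → Ed d} {C L : ℝ}
    (hC : ∀ x y θ, ‖tangentKernel Kgrad x y θ‖ ≤ C)
    (hL : ∀ x x' y y' θ, ‖tangentKernel Kgrad x y θ - tangentKernel Kgrad x' y' θ‖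
      ≤ L * (‖x - x'‖ + ‖y - y'‖))
    (hcont : ∀ x y, Continuous fun θ => tangentKernel Kgrad x y θ)
    (ν : Measure (Ed α)) [IsFiniteMeasure ν] (u : Measure (Ed d)) [IsFiniteMeasure u]
    (hu : ∀ᵐ y ∂u, ‖y‖ = 1) {x : Ed d} (hx : ‖x‖ = 1) :
    ∫ θ, DKer Kgrad u x θ ∂ν = ∫ y, ∫ θ, tangentKernel Kgrad x y θ ∂ν ∂u := by
  have e : ∀ θ, DKer Kgrad u x θ = ∫ y, tangentKernel Kgrad x y θ ∂u := fun θ =>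
    integral_congr_ae (hu.mono fun y hy => (tangentKernel_of_norm_eq_one hx hy θ).symm)
  simp_rw [e]
  refine integral_integral_swap ?_
  have hc : Continuous (Function.uncurry fun θ y => tangentKernel Kgrad x y θ) := by
    refine continuous_prod_of_continuous_lipschitzWith' _ L.toNNReal (fun θ => ?_)
      (fun y => hcont x y)
    refine LipschitzWith.of_dist_le_mul fun y y' => ?_
    rw [dist_eq_norm, dist_eq_norm]
    refine (hL x x y y' θ).trans ?_
    rw [sub_self, norm_zero, zero_add]
    exact mul_le_mul_of_nonneg_right (Real.le_coe_toNNReal L) (norm_nonneg _)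
  exact Integrable.of_bound hc.aestronglyMeasurable C (Eventually.of_forall fun p => hC _ _ _)

lemma inner_integral_eq_zero {Ω E : Type*} [MeasurableSpace Ω] [NormedAddCommGroup E]
    [InnerProductSpace ℝ E] [CompleteSpace E] {μ : Measure Ω} {F : Ω → E} {z : E}
    (hF : Integrable F μ) (h : ∀ ω, ⟪F ω, z⟫ = 0) : ⟪∫ ω, F ω ∂μ, z⟫ = 0 := by
  rw [real_inner_comm, ← integral_inner hF]
  exact integral_eq_zero_of_ae (Eventually.of_forall fun ω => (real_inner_comm _ _).trans (h ω))

end AveragedKernel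

/-- **Existence of weak solutions of the (unnormalized) continuity equation.**
Under (K1)–(K3) for the kernel `𝒦` (with gradient `Kgrad`) and a narrowly
continuous compactly supported weak Fokker–Planck solution `Θ_t`, every initial
probability measure `u⁰` on the sphere is the starting point of a narrowly
continuous, `AC²` curve of probability measures on the sphere solving the
continuity equation `∂_t u = div(u ∫ 𝒟𝒦[u] dΘ_t)` weakly. -/
theorem continuity_equation_exists
    (d α ξ : ℕ) (hd : 2 ≤ d) (hα : 1 ≤ α) (T : ℝ) (hT : 0 < T)
    (K : Ed d → Ed d → Ed α → ℝ) (Kgrad : Ed d → Ed d → Ed α → Ed d)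
    -- (K1)
    (QK : Set (Ed α)) (hQK : IsCompact QK)
    (hK1 : ∀ x y : Ed d, x ∈ Sph d → y ∈ Sph d → ∀ θ ∉ QK, K x y θ = 0)
    -- (K2)
    (hKC1 : ∀ θ, ContDiff ℝ 1 (fun p : Ed d × Ed d => K p.1 p.2 θ))
    (hgrad : ∀ y θ x, HasGradientAt (fun x' => K x' y θ) (Kgrad x y θ) x)
    (B LK : ℝ)
    (hB : ∀ x y : Ed d, x ∈ Sph d → y ∈ Sph d → ∀ θ, ‖Kgrad x y θ‖ ≤ B)
    (hLK : ∀ x x' y y' : Ed d, x ∈ Sph d → x' ∈ Sph d → y ∈ Sph d → y' ∈ Sph d →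
      ∀ θ, ‖Kgrad x y θ - Kgrad x' y' θ‖ ≤ LK * (‖x - x'‖ + ‖y - y'‖))
    (hKC2 : ∀ x y, ContDiff ℝ 2 (fun θ => K x y θ))
    -- (K3)
    (hK3 : ∀ x y θ, K x y θ = K y x θ)
    -- weight dynamics
    (Θ : ℝ → Measure (Ed α))
    (hΘprob : ∀ t ∈ Icc (0:ℝ) T, IsProbabilityMeasure (Θ t))
    (QΘ : Set (Ed α)) (hQΘ : IsCompact QΘ)
    (hΘsupp : ∀ t ∈ Icc (0:ℝ) T, Θ t QΘᶜ = 0)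
    (hΘnarrow : NarrowlyContinuousOn Θ (Icc 0 T))
    (f : Ed α → ℝ → Ed α) (g : Ed α → ℝ → Matrix (Fin α) (Fin ξ) ℝ)
    (hfint : ∃ Cf : ℝ → ℝ, IntegrableOn Cf (Ioc 0 T) ∧
      ∀ t ∈ Ioc (0:ℝ) T, ∀ θ ∈ QΘ, ‖f θ t‖ ≤ Cf t)
    (hgint : ∃ Cg : ℝ → ℝ, IntegrableOn Cg (Ioc 0 T) ∧
      ∀ t ∈ Ioc (0:ℝ) T, ∀ θ ∈ QΘ, (∑ i, ∑ j, (g θ t i j) ^ 2) ≤ Cg t)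
    (hFP : WeakFP T f g Θ)
    -- initial datum
    (u0 : Measure (Ed d)) [IsProbabilityMeasure u0] (hu0 : u0 (Sph d)ᶜ = 0) :
    ∃ u : ℝ → Measure (Ed d),
      (∀ t ∈ Icc (0:ℝ) T, IsProbabilityMeasure (u t) ∧ (u t) (Sph d)ᶜ = 0) ∧
      u 0 = u0 ∧
      NarrowlyContinuousOn u (Icc 0 T) ∧
      AC2 T u ∧
      WeakContinuityEq T Kgrad Θ u := by
  have hB' : ∀ x y : Ed d, ‖x‖ = 1 → ‖y‖ = 1 → ∀ θ, ‖Kgrad x y θ‖ ≤ |B| :=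
    fun x y hx hy θ => (hB x y hx hy θ).trans (le_abs_self B)
  have hL' : ∀ x x' y y' : Ed d, ‖x‖ = 1 → ‖x'‖ = 1 → ‖y‖ = 1 → ‖y'‖ = 1 →
      ∀ θ, ‖Kgrad x y θ - Kgrad x' y' θ‖ ≤ |LK| * (‖x - x'‖ + ‖y - y'‖) :=
    fun x x' y y' hx hx' hy hy' θ => (hLK x x' y y' hx hx' hy hy' θ).trans
      (mul_le_mul_of_nonneg_right (le_abs_self LK) (by positivity))
  obtain ⟨M, hM⟩ : ∃ M, ∀ x y θ, ‖tangentKernel Kgrad x y θ‖ ≤ M :=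
    ⟨2 * |B|, norm_tangentKernel_le (abs_nonneg B) hB'⟩
  obtain ⟨L, hL0, hL⟩ : ∃ L : ℝ, 0 ≤ L ∧ ∀ x x' y y' θ,
      ‖tangentKernel Kgrad x y θ - tangentKernel Kgrad x' y' θ‖ ≤ L * (‖x - x'‖ + ‖y - y'‖) :=
    ⟨6 * |B| + 4 * |LK|, by positivity,
      norm_tangentKernel_sub_le (abs_nonneg B) (abs_nonneg LK) hB' hL'⟩
  have hEθ : ∀ x y, Continuous fun θ => tangentKernel Kgrad x y θ :=
    continuous_tangentKernel_param hgrad hB' hL' fun x y => (hKC2 x y).continuous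
  set τ : ℝ → ℝ := fun t => (projIcc 0 T hT.le t : ℝ) with hτdef
  have hτ : Continuous τ := continuous_subtype_val.comp continuous_projIcc
  have hτm : ∀ t, τ t ∈ Icc 0 T := fun t => (projIcc 0 T hT.le t).2
  have hτe : ∀ t ∈ Icc 0 T, τ t = t := fun t ht => by simp [hτdef, projIcc_of_mem hT.le ht]
  have hΘτ : ∀ t, IsProbabilityMeasure (Θ (τ t)) := fun t => hΘprob _ (hτm t)
  have hEint : ∀ t x y, Integrable (fun θ => tangentKernel Kgrad x y θ) (Θ (τ t)) := fun t x y =>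
    Integrable.of_bound (hEθ x y).aestronglyMeasurable M (Eventually.of_forall (hM x y))
  set W : ℝ → Ed d → Ed d → Ed d := fun t x y => ∫ θ, tangentKernel Kgrad x y θ ∂(Θ (τ t))
    with hW
  have hWM : ∀ t x y, ‖W t x y‖ ≤ M := fun t x y => by
    simpa using norm_integral_le_of_norm_le_const (μ := Θ (τ t)) (C := M)
      (Eventually.of_forall (hM x y))
  have hM0 : 0 ≤ M := (norm_nonneg _).trans (hWM 0 0 0)
  have hWL : ∀ t x x' y y', ‖W t x y - W t x' y'‖ ≤ L * (‖x - x'‖ + ‖y - y'‖) := by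
    intro t x x' y y'
    rw [hW]
    simp only
    rw [← integral_sub (hEint t x y) (hEint t x' y')]
    simpa using norm_integral_le_of_norm_le_const (μ := Θ (τ t))
      (Eventually.of_forall (hL x x' y y'))
  have hWt : ∀ x y, Continuous fun t => W t x y := fun x y =>
    (hΘnarrow.continuousOn_integral (fun t ht => by have := hΘprob t ht; infer_instance) (hEθ x y)
      (hM x y)).comp_continuous hτ hτm
  have hWc := continuous_of_norm_sub_le hWL hWt
  have hWo : ∀ t x y, ⟪W t x y, x⟫ = 0 := fun t x y =>
    inner_integral_eq_zero (hEint t x y) fun θ => inner_tangentKernel x y θ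
  have hretr : Continuous (radialExt (id : Ed d → Ed d)) := by
    refine LipschitzWith.continuous (K := 3) (LipschitzWith.of_dist_le_mul fun x y => ?_)
    rw [dist_eq_norm, dist_eq_norm]
    refine (norm_radialExt_sub_le (M := 1) (L := 1) zero_le_one zero_le_one
      (fun x hx => hx.le) (fun x y _ _ => by simp) x y).trans ?_
    norm_num
  obtain ⟨X, Y, hX0, hYc, hXd, hY⟩ := exists_meanField_flow hT.le hL0 hWM hWL hWt u0
    (BoundedContinuousFunction.ofNormedAddCommGroup (radialExt id) hretr 1
      (norm_radialExt_le' zero_le_one fun x hx => hx.le))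
  have hXm : ∀ t, Measurable (X t) := fun t => (X t).continuous.measurable
  have hu0' : ∀ᵐ x ∂u0, ‖x‖ = 1 := hu0
  have hX0' : ∀ x, ‖x‖ = 1 → X 0 x = x := fun x hx => by
    rw [hX0]; exact radialExt_of_norm_eq_one id hx
  have hWint : ∀ t x, Integrable (fun y => W t x (X t y)) u0 := fun t x =>
    Integrable.of_bound (Continuous.aestronglyMeasurable
      (hWc.comp (continuous_const.prodMk (continuous_const.prodMk (X t).continuous)))) M
      (Eventually.of_forall fun y => hWM _ _ _)
  have hXS : ∀ t ∈ Icc 0 T, ∀ x, ‖x‖ = 1 → ‖X t x‖ = 1 := by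
    intro t ht x hx
    rw [norm_flow_eq (fun t ht => hasDerivWithinAt_eval (hXd t ht) x) (fun t _ => ?_) ht,
      hX0' x hx, hx]
    rw [hY, inner_neg_left, inner_integral_eq_zero (hWint _ _) fun y => hWo _ _ _, neg_zero]
  have hXae : ∀ t ∈ Icc 0 T, ∀ᵐ z ∂(u0.map (X t)), ‖z‖ = 1 := fun t ht =>
    (ae_map_iff (hXm t).aemeasurable (isClosed_singleton.preimage continuous_norm).measurableSet).2
      (hu0'.mono (hXS t ht))
  have hXc : ContinuousOn X (Icc 0 T) := fun t ht => (hXd t ht).continuousWithinAt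
  have hprob : ∀ t, IsProbabilityMeasure (u0.map (X t)) := fun t =>
    Measure.isProbabilityMeasure_map (hXm t).aemeasurable
  refine ⟨fun t => u0.map (X t), fun t ht => ⟨hprob t, hXae t ht⟩, ?_, ?_, ?_, ?_⟩
  · calc u0.map (X 0) = u0.map id := Measure.map_congr (hu0'.mono hX0')
      _ = u0 := Measure.map_id
  · intro φ
    have e : ∀ t, ∫ x, φ x ∂(u0.map (X t)) = ∫ x, φ (X t x) ∂u0 := fun t =>
      integral_map (hXm t).aemeasurable φ.continuous.aestronglyMeasurable
    simp only [e]
    refine continuousOn_of_dominated (bound := fun _ => ‖φ‖)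
      (fun t _ => (φ.continuous.comp (X t).continuous).aestronglyMeasurable)
      (fun t _ => Eventually.of_forall fun x => φ.norm_coe_le_norm _) (integrable_const _)
      (Eventually.of_forall fun x => φ.continuous.comp_continuousOn fun t ht =>
        (hasDerivWithinAt_eval (hXd t ht) x).continuousWithinAt)
  · refine ⟨fun _ => M, fun _ => hM0, integrableOn_const (by simp), fun s r hs hsr hr => ?_⟩
    rw [intervalIntegral.integral_const, smul_eq_mul, mul_comm]
    refine W2_map_le u0 ?_
    have h := (convex_Icc (0:ℝ) T).norm_image_sub_le_of_norm_hasDerivWithin_le (C := M) hXd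
      (fun t _ => (BoundedContinuousFunction.norm_le hM0).2 fun x => ?_)
      (⟨hs.trans hsr, hr⟩ : r ∈ Icc 0 T) (⟨hs, hsr.trans hr⟩ : s ∈ Icc 0 T)
    · rwa [norm_sub_rev s r, Real.norm_of_nonneg (sub_nonneg.2 hsr)] at h
    · rw [hY, norm_neg]
      simpa using norm_integral_le_of_norm_le_const (μ := u0) (C := M)
        (Eventually.of_forall fun y => hWM t (X t x) (X t y))
  · rintro φ hφ ⟨Kt, -, hKt, hφ0⟩
    set Φ : Ed d × ℝ → ℝ := fun p => φ p.1 p.2 with hΦ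
    have hΦ1 : ContDiff ℝ 1 Φ := hφ.of_le (by exact_mod_cast le_top)
    refine Eq.trans ?_ (integral_fderiv_flow_eq_zero hT.le hYc hXd u0 hΦ1
      (fun x => hφ0 x 0 fun h => lt_irrefl _ (hKt h).1)
      (fun x => hφ0 x T fun h => lt_irrefl _ (hKt h).2))
    refine intervalIntegral.integral_congr fun t ht => ?_
    rw [uIcc_of_le hT.le] at ht
    simp only
    set w : Ed d → Ed d := fun z => ∫ y, W t z y ∂(u0.map (X t)) with hw
    have hWz : ∀ z, Continuous fun y => W t z y := fun z =>
      hWc.comp (continuous_const.prodMk (continuous_const.prodMk continuous_id))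
    have hwc : Continuous w := by
      refine continuous_of_dominated (bound := fun _ => M)
        (fun z => (hWz z).aestronglyMeasurable) (fun z => Eventually.of_forall fun y => hWM _ _ _)
        (integrable_const _) (Eventually.of_forall fun y => ?_)
      exact hWc.comp (continuous_const.prodMk (continuous_id.prodMk continuous_const))
    have hwY : ∀ x, Y t x = -w (X t x) := fun x => by
      rw [hY, hw]
      simp only
      rw [integral_map (hXm t).aemeasurable (hWz _).aestronglyMeasurable]
    have hwo : ∀ z, ⟪w z, z⟫ = 0 := fun z => inner_integral_eq_zero
      (Integrable.of_bound (hWz z).aestronglyMeasurable M (Eventually.of_forall fun y => hWM _ _ _))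
      fun y => hWo _ _ _
    have hpoint : ∀ᵐ z ∂(u0.map (X t)), deriv (fun s => φ z s) t
        - ⟪Pperp z (gradient (fun y => φ y t) z), ∫ θ, DKer Kgrad (u0.map (X t)) z θ ∂(Θ t)⟫
        = fderiv ℝ Φ (z, t) (-w z, 1) := by
      filter_upwards [hXae t ht] with z hz
      have := hΘprob t ht
      have hDK : ∫ θ, DKer Kgrad (u0.map (X t)) z θ ∂(Θ t) = w z := by
        rw [integral_DKer_eq hM hL hEθ _ _ (hXae t ht) hz, hw, hW]
        simp only [hτe t ht]
      have hd : HasFDerivAt Φ (fderiv ℝ Φ (z, t)) (z, t) :=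
        (hΦ1.differentiable one_ne_zero).differentiableAt.hasFDerivAt
      have hdt : HasDerivAt (fun s => φ z s) (fderiv ℝ Φ (z, t) (0, 1)) t :=
        HasFDerivAt.comp_hasDerivAt (f := fun s => (z, s)) t hd
          ((hasDerivAt_const t z).prodMk (hasDerivAt_id t))
      have hdz : HasFDerivAt (fun y => φ y t)
          ((fderiv ℝ Φ (z, t)).comp (ContinuousLinearMap.inl ℝ (Ed d) ℝ)) z :=
        HasFDerivAt.comp (f := fun y => (y, t)) z hd (hasFDerivAt_prodMk_left z t)
      rw [hDK, inner_Pperp_left, Pperp_of_inner_eq_zero (hwo z), hdt.deriv, gradient,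
        InnerProductSpace.toDual_symm_apply, hdz.fderiv]
      have e : ((-w z, 1) : Ed d × ℝ) = (0, 1) - (w z, 0) := by simp
      rw [e, map_sub]
      rfl
    rw [integral_congr_ae hpoint, integral_map (hXm t).aemeasurable]
    · simp only [hwY]
    · exact Continuous.aestronglyMeasurable
        (((hΦ1.continuous_fderiv one_ne_zero).comp
          (continuous_id.prodMk continuous_const)).clm_apply (hwc.neg.prodMk continuous_const))

end
end

section
/- Let X and Y be compact metric spaces, u : [0, ∞) → X, Θ : [0, ∞) → Y, and G : X × Y → [0, ∞) continuous. Assume that t ↦ G(u(t), Θ(t)) is uniformly continuous on [0, ∞) and that there exists a function F : [0, ∞) → ℝ, bounded from below, such that (1/2)·∫_s^r G(u(t), Θ(t))² dt ≤ F(s) − F(r) for all 0 ≤ s ≤ r < ∞. Then: (i) G(u(t), Θ(t)) → 0 as t → ∞; (ii) the ω-limit set ω_u = {φ ∈ X : there exist t_n ↗ ∞ with u(t_n) → φ} is nonempty; (iii) for every φ ∈ ω_u there exists a cluster point Θ̄ of Θ(t) as t → ∞ (i.e. Θ̄ = lim_n Θ(s_n) for some s_n ↗ ∞) such that G(φ,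 Θ̄) = 0. In particular, ω_u ⊆ ⋃_{Θ̄ ∈ Ω(Θ)} {φ ∈ X : G(φ, Θ̄) = 0}, where Ω(Θ) is the set of cluster points of Θ(t) as t → ∞. -/
open Filter Topology Set intervalIntegral

/-- An antitone function on `[0,∞)` that is bounded below has vanishing increments at infinity. -/
theorem tendsto_sub_shift_zero_of_antitoneOn {F : ℝ → ℝ} {C : ℝ} (hF : AntitoneOn F (Ici 0))
    (hC : ∀ t : ℝ, 0 ≤ t → C ≤ F t) (δ : ℝ) :
    Tendsto (fun s => F s - F (s + δ)) atTop (𝓝 0) := by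
  have hanti : Antitone fun t => F (max t 0) := fun a b hab =>
    hF (le_max_right a 0) (le_max_right b 0) (max_le_max_right 0 hab)
  have hbdd : BddBelow (range fun t => F (max t 0)) :=
    ⟨C, by rintro _ ⟨t, rfl⟩; exact hC _ (le_max_right t 0)⟩
  have hlim : Tendsto F atTop (𝓝 (⨅ t, F (max t 0))) :=
    (tendsto_atTop_ciInf hanti hbdd).congr' <| by
      filter_upwards [eventually_ge_atTop 0] with t ht
      rw [max_eq_left ht]
  simpa using hlim.sub (hlim.comp (tendsto_atTop_add_const_right atTop δ tendsto_id))

/-- A Barbalat-type lemma: a nonnegative, uniformly continuous function on `[0,∞)` whose squared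
integrals are controlled by the decrease of a function bounded below tends to zero. -/
theorem tendsto_zero_of_uniformContinuousOn_of_integral_sq_le {g F : ℝ → ℝ} {C : ℝ}
    (hg : ∀ t, 0 ≤ g t) (hUC : UniformContinuousOn g (Ici 0))
    (hC : ∀ t : ℝ, 0 ≤ t → C ≤ F t)
    (hdissip : ∀ s r : ℝ, 0 ≤ s → s ≤ r →
      (1 / 2 : ℝ) * ∫ t in s..r, (g t) ^ 2 ≤ F s - F r) :
    Tendsto g atTop (𝓝 0) := by
  have hF : AntitoneOn F (Ici 0) := by
    intro s hs r _ hsr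
    have h₁ := hdissip s r hs hsr
    have h₂ : 0 ≤ ∫ t in s..r, (g t) ^ 2 := integral_nonneg hsr fun t _ => sq_nonneg (g t)
    linarith
  rw [Metric.tendsto_nhds]
  intro ε hε
  obtain ⟨δ, hδ, hgδ⟩ := Metric.uniformContinuousOn_iff_le.1 hUC (ε / 2) (half_pos hε)
  have hsmall := (tendsto_sub_shift_zero_of_antitoneOn hF hC δ).eventually_lt_const
    (show 0 < (1 / 2 : ℝ) * (δ * (ε / 2) ^ 2) by positivity)
  filter_upwards [hsmall, eventually_ge_atTop 0] with s hs hs0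
  rw [Real.dist_eq, sub_zero, abs_of_nonneg (hg s)]
  by_contra! hlt
  have hsδ : s ≤ s + δ := by linarith
  have hint : IntervalIntegrable (fun t => (g t) ^ 2) MeasureTheory.volume s (s + δ) := by
    refine ContinuousOn.intervalIntegrable ((hUC.continuousOn.mono ?_).pow 2)
    rw [uIcc_of_le hsδ]
    exact fun t ht => hs0.trans ht.1
  have hlower : ∫ _ in s..s + δ, (ε / 2) ^ 2 ≤ ∫ t in s..s + δ, (g t) ^ 2 := by
    refine integral_mono_on hsδ intervalIntegrable_const hint fun t ht => ?_
    have hdist := hgδ s hs0 t (hs0.trans ht.1) (by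
      rw [dist_comm, Real.dist_eq, abs_of_nonneg] <;> linarith [ht.1, ht.2])
    rw [Real.dist_eq] at hdist
    exact pow_le_pow_left₀ (by positivity) (by linarith [le_abs_self (g s - g t)]) 2
  rw [intervalIntegral.integral_const, smul_eq_mul, add_sub_cancel_left] at hlower
  linarith [hdissip s (s + δ) hs0 hsδ]

/-- A curve in a compact metric space has a cluster point along a subsequence of any strictly
increasing sequence of times tending to infinity. -/
theorem exists_tendsto_comp_of_strictMono {Z : Type*} [MetricSpace Z] [CompactSpace Z]
    (v : ℝ → Z) {tn : ℕ → ℝ} (hmono : StrictMono tn) (htop : Tendsto tn atTop atTop) :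
    ∃ (z : Z) (k : ℕ → ℕ), StrictMono k ∧ StrictMono (tn ∘ k) ∧ Tendsto (tn ∘ k) atTop atTop ∧
      Tendsto (fun n => v (tn (k n))) atTop (𝓝 z) := by
  obtain ⟨z, k, hk, hz⟩ := CompactSpace.tendsto_subseq fun n => v (tn n)
  exact ⟨z, k, hk, hmono.comp hk, htop.comp hk.tendsto_atTop, hz⟩

/-- **Abstract long-time behavior.**
If `t ↦ G(u(t), Θ(t))` is uniformly continuous on `[0,∞)` and
`½∫_s^r G² ≤ F(s) − F(r)` for a function `F` bounded below, then
`G(u(t), Θ(t)) → 0`, the ω-limit set of `u` is nonempty, and every ω-limit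
point `φ` of `u` is a zero of `G(·, Θ̄)` for some cluster point `Θ̄` of `Θ`. -/
theorem longtime_behavior
    {X Y : Type*} [MetricSpace X] [CompactSpace X] [MetricSpace Y] [CompactSpace Y]
    [Nonempty X] [Nonempty Y]
    (u : ℝ → X) (Θ : ℝ → Y) (G : X → Y → ℝ)
    (hGcont : Continuous (fun p : X × Y => G p.1 p.2))
    (hGnonneg : ∀ x y, 0 ≤ G x y)
    (hUC : UniformContinuousOn (fun t => G (u t) (Θ t)) (Ici 0))
    (F : ℝ → ℝ) (hFbdd : ∃ C : ℝ, ∀ t : ℝ, 0 ≤ t → C ≤ F t)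
    (hdissip : ∀ s r : ℝ, 0 ≤ s → s ≤ r →
      (1 / 2 : ℝ) * ∫ t in s..r, (G (u t) (Θ t)) ^ 2 ≤ F s - F r) :
    (Tendsto (fun t => G (u t) (Θ t)) atTop (𝓝 0)) ∧
    (∃ (φ : X) (tn : ℕ → ℝ), StrictMono tn ∧ Tendsto tn atTop atTop ∧
      Tendsto (fun n => u (tn n)) atTop (𝓝 φ)) ∧
    (∀ φ : X,
      (∃ tn : ℕ → ℝ, StrictMono tn ∧ Tendsto tn atTop atTop ∧
        Tendsto (fun n => u (tn n)) atTop (𝓝 φ)) →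
      ∃ Θbar : Y,
        (∃ sn : ℕ → ℝ, StrictMono sn ∧ Tendsto sn atTop atTop ∧
          Tendsto (fun n => Θ (sn n)) atTop (𝓝 Θbar)) ∧
        G φ Θbar = 0) := by
  obtain ⟨C, hC⟩ := hFbdd
  have hlim : Tendsto (fun t => G (u t) (Θ t)) atTop (𝓝 0) :=
    tendsto_zero_of_uniformContinuousOn_of_integral_sq_le (fun t => hGnonneg _ _) hUC hC hdissip
  refine ⟨hlim, ?_, ?_⟩
  · obtain ⟨φ, k, -, hmono, htop, hφ⟩ :=
      exists_tendsto_comp_of_strictMono u Nat.strictMono_cast tendsto_natCast_atTop_atTop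
    exact ⟨φ, _, hmono, htop, hφ⟩
  · rintro φ ⟨tn, hmono, htop, hφ⟩
    obtain ⟨Θbar, k, hk, hkmono, hktop, hΘ⟩ := exists_tendsto_comp_of_strictMono Θ hmono htop
    have hG : Tendsto (fun n => G (u (tn (k n))) (Θ (tn (k n)))) atTop (𝓝 (G φ Θbar)) :=
      (hGcont.tendsto (φ, Θbar)).comp ((hφ.comp hk.tendsto_atTop).prodMk_nhds hΘ)
    exact ⟨Θbar, ⟨_, hkmono, hktop, hΘ⟩, tendsto_nhds_unique hG (hlim.comp hktop)⟩
end

section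
/- Let d ≥ 2, α ≥ 1, τ > 0, let ν be a Borel probability measure on S^{d−1}, let Θ be a Borel probability measure on ℝ^α supported in a compact set Q, and let 𝒦 : ℝ^d × ℝ^d × ℝ^α → ℝ be continuous with 𝒦(x, y, θ) = 0 for all x, y ∈ S^{d−1} and θ ∉ Q. Define ℰ(μ) = (1/2)·∫_{ℝ^α}∫_{S^{d−1}}∫_{S^{d−1}} 𝒦(x, y, θ) dμ(y) dμ(x) dΘ(θ) and W₂(μ, ν) = (inf_γ ∫‖x − y‖² dγ(x, y))^{1/2}, the infimum over all couplings γ of μ and ν. Then there exists a Borel probability measure u on S^{d−1} minimizing μ ↦ W₂²(μ, ν)/(2τ) + ℰ(μ) over all Borel probability measures on S^{d−1}. -/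
open MeasureTheory Set

noncomputable section

/-- Squared Wasserstein-2 distance, as the infimum of the quadratic transport
cost over all couplings. -/
def W2sq {d : ℕ} (μ ν : Measure (Ed d)) : ℝ :=
  sInf {r : ℝ | ∃ γ : Measure (Ed d × Ed d), IsProbabilityMeasure γ ∧
    γ.map Prod.fst = μ ∧ γ.map Prod.snd = ν ∧ r = ∫ p, ‖p.1 - p.2‖ ^ 2 ∂γ}

/-- A probability measure concentrated on the range of a measurable embedding is the push-forward
of a probability measure. -/
theorem MeasurableEmbedding.exists_probabilityMeasure_map_eq {X Y : Type*} [MeasurableSpace X]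
    [MeasurableSpace Y] {f : X → Y} (hf : MeasurableEmbedding f) (μ : Measure Y)
    [IsProbabilityMeasure μ] (hμ : μ (range f)ᶜ = 0) :
    ∃ m : ProbabilityMeasure X, (m : Measure X).map f = μ := by
  have hmap : (μ.comap f).map f = μ := by
    rw [hf.map_comap]
    exact Measure.restrict_eq_self_of_ae_mem (mem_ae_iff.2 hμ)
  have hprob : IsProbabilityMeasure (μ.comap f) := by
    constructor
    rw [← preimage_univ (f := f), ← hf.map_apply, hmap, measure_univ]
  exact ⟨⟨μ.comap f, hprob⟩, hmap⟩

/-- Among the couplings with a prescribed second marginal on a compact space, a continuous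
transport cost plus a narrowly continuous functional of the first marginal attains its minimum. -/
theorem exists_coupling_minimizing {X : Type*} [TopologicalSpace X] [CompactSpace X]
    [TopologicalSpace.MetrizableSpace X] [SecondCountableTopology X]
    [MeasurableSpace X] [BorelSpace X] {c : X × X → ℝ}
    (hc : Continuous c) {F : ProbabilityMeasure X → ℝ} (hF : Continuous F)
    (ν : ProbabilityMeasure X) :
    ∃ γ : ProbabilityMeasure (X × X), γ.map measurable_snd.aemeasurable = ν ∧
      ∀ γ' : ProbabilityMeasure (X × X), γ'.map measurable_snd.aemeasurable = ν →
        ∫ p, c p ∂(γ : Measure (X × X)) + F (γ.map measurable_fst.aemeasurable) ≤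
          ∫ p, c p ∂(γ' : Measure (X × X)) + F (γ'.map measurable_fst.aemeasurable) := by
  have hclosed : IsClosed
      {γ : ProbabilityMeasure (X × X) | γ.map measurable_snd.aemeasurable = ν} :=
    isClosed_eq (ProbabilityMeasure.continuous_map continuous_snd) continuous_const
  have hcont : Continuous fun γ : ProbabilityMeasure (X × X) =>
      ∫ p, c p ∂(γ : Measure (X × X)) + F (γ.map measurable_fst.aemeasurable) :=
    (ProbabilityMeasure.continuous_integral_continuousMap (⟨c, hc⟩ : C(X × X, ℝ))).add
      (hF.comp (ProbabilityMeasure.continuous_map continuous_fst))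
  obtain ⟨γ, hγ, hmin⟩ := hclosed.isCompact.exists_isMinOn
    ⟨ν.prod ν, ProbabilityMeasure.map_snd_prod ν ν⟩ hcont.continuousOn
  exact ⟨γ, hγ, fun γ' hγ' => hmin hγ'⟩

/-- The interaction energy with a continuous kernel on compact spaces is narrowly continuous. -/
theorem continuous_interactionEnergy {X T : Type*} [TopologicalSpace X] [CompactSpace X]
    [TopologicalSpace.MetrizableSpace X] [SecondCountableTopology X]
    [MeasurableSpace X] [BorelSpace X] [TopologicalSpace T] [CompactSpace T]
    [TopologicalSpace.MetrizableSpace T] [SecondCountableTopology T]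
    [MeasurableSpace T] [BorelSpace T] (Θ : ProbabilityMeasure T) {k : X → X → T → ℝ}
    (hk : Continuous fun p : T × X × X => k p.2.1 p.2.2 p.1) :
    Continuous fun μ : ProbabilityMeasure X =>
      ∫ θ, ∫ x, ∫ y, k x y θ ∂(μ : Measure X) ∂(μ : Measure X) ∂(Θ : Measure T) := by
  have hcont : Continuous fun μ : ProbabilityMeasure X =>
      ∫ p, k p.2.1 p.2.2 p.1 ∂((Θ.prod (μ.prod μ) : ProbabilityMeasure (T × X × X)) :
        Measure (T × X × X)) :=
    (ProbabilityMeasure.continuous_integral_continuousMap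
      (⟨_, hk⟩ : C(T × X × X, ℝ))).comp (by fun_prop)
  convert hcont using 2 with μ
  rw [ProbabilityMeasure.toMeasure_prod, ProbabilityMeasure.toMeasure_prod, integral_prod]
  · refine integral_congr_ae (.of_forall fun θ => ?_)
    have hθ : Continuous fun q : X × X => k q.1 q.2 θ :=
      hk.comp (Continuous.prodMk_right θ)
    exact (integral_prod _ (hθ.integrable_of_hasCompactSupport (.of_compactSpace _))).symm
  · exact hk.integrable_of_hasCompactSupport (.of_compactSpace _)

/-- The squared Wasserstein distance is at most the cost of any coupling. -/
theorem W2sq_le {d : ℕ} {μ ν : Measure (Ed d)} (γ : Measure (Ed d × Ed d))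
    [IsProbabilityMeasure γ] (hfst : γ.map Prod.fst = μ) (hsnd : γ.map Prod.snd = ν) :
    W2sq μ ν ≤ ∫ p, ‖p.1 - p.2‖ ^ 2 ∂γ := by
  refine csInf_le ⟨0, ?_⟩ ⟨γ, inferInstance, hfst, hsnd, rfl⟩
  rintro r ⟨γ', -, -, -, rfl⟩
  positivity

/-- A lower bound for the cost of all couplings is a lower bound for the squared Wasserstein
distance. -/
theorem le_W2sq {d : ℕ} {μ ν : Measure (Ed d)} [IsProbabilityMeasure μ] [IsProbabilityMeasure ν]
    {a : ℝ} (h : ∀ γ : Measure (Ed d × Ed d), IsProbabilityMeasure γ → γ.map Prod.fst = μ →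
      γ.map Prod.snd = ν → a ≤ ∫ p, ‖p.1 - p.2‖ ^ 2 ∂γ) :
    a ≤ W2sq μ ν := by
  refine le_csInf ⟨_, μ.prod ν, inferInstance, by simp, by simp, rfl⟩ ?_
  rintro r ⟨γ, hγ, hfst, hsnd, rfl⟩
  exact h γ hγ hfst hsnd

/-- **Existence of the one-step JKO minimizer.**
For the interaction energy `ℰ(μ) = ½ ∫∫∫ 𝒦 dμ dμ dΘ` with `𝒦` continuous and
vanishing (on the sphere) outside a compact set of parameters containing the
support of `Θ`, the functional `μ ↦ W₂²(μ,ν)/(2τ) + ℰ(μ)` admits a minimizer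
among Borel probability measures on the sphere `S^{d−1}`. -/
theorem jko_step_exists
    (d α : ℕ) (hd : 2 ≤ d) (hα : 1 ≤ α) (τ : ℝ) (hτ : 0 < τ)
    (ν : Measure (Ed d)) [IsProbabilityMeasure ν]
    (hν : ν {x : Ed d | ‖x‖ = 1}ᶜ = 0)
    (Q : Set (Ed α)) (hQ : IsCompact Q)
    (Θ : Measure (Ed α)) [IsProbabilityMeasure Θ] (hΘ : Θ Qᶜ = 0)
    (K : Ed d → Ed d → Ed α → ℝ)
    (hKcont : Continuous (fun p : Ed d × Ed d × Ed α => K p.1 p.2.1 p.2.2))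
    (hK0 : ∀ x y : Ed d, ‖x‖ = 1 → ‖y‖ = 1 → ∀ θ ∉ Q, K x y θ = 0) :
    ∃ u : Measure (Ed d), IsProbabilityMeasure u ∧ u {x : Ed d | ‖x‖ = 1}ᶜ = 0 ∧
      ∀ μ : Measure (Ed d), IsProbabilityMeasure μ → μ {x : Ed d | ‖x‖ = 1}ᶜ = 0 →
        W2sq u ν / (2 * τ)
            + (1 / 2 : ℝ) * ∫ θ, (∫ x, (∫ y, K x y θ ∂u) ∂u) ∂Θ ≤
          W2sq μ ν / (2 * τ)
            + (1 / 2 : ℝ) * ∫ θ, (∫ x, (∫ y, K x y θ ∂μ) ∂μ) ∂Θ := by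
  have hS : IsCompact {x : Ed d | ‖x‖ = 1} := by
    simpa [Metric.sphere, dist_zero_right] using isCompact_sphere (0 : Ed d) 1
  set S : Set (Ed d) := {x : Ed d | ‖x‖ = 1}
  have : CompactSpace S := isCompact_iff_compactSpace.1 hS
  have : CompactSpace Q := isCompact_iff_compactSpace.1 hQ
  have hemb : MeasurableEmbedding (Subtype.val : S → Ed d) :=
    .subtype_coe hS.measurableSet
  have hembQ : MeasurableEmbedding (Subtype.val : Q → Ed α) :=
    .subtype_coe hQ.measurableSet
  have hemb₂ : MeasurableEmbedding (Prod.map Subtype.val Subtype.val : S × S → Ed d × Ed d) :=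
    hemb.prodMap hemb
  obtain ⟨ν', rfl⟩ := hemb.exists_probabilityMeasure_map_eq ν (by simpa using hν)
  obtain ⟨Θ', rfl⟩ := hembQ.exists_probabilityMeasure_map_eq Θ (by simpa using hΘ)
  simp only [hembQ.integral_map]
  have hF : Continuous fun μ : ProbabilityMeasure S => (1 / 2 : ℝ) *
      ∫ θ : Q, ∫ x : S, ∫ y : S, K x y θ ∂(μ : Measure S) ∂(μ : Measure S) ∂(Θ' : Measure Q) :=
    continuous_const.mul (continuous_interactionEnergy Θ' (k := fun (x y : S) (θ : Q) => K x y θ)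
      (hKcont.comp (f := fun p : Q × S × S => ((p.2.1 : Ed d), (p.2.2 : Ed d), (p.1 : Ed α)))
        (by fun_prop)))
  have hc : Continuous fun p : S × S => ‖(p.1 : Ed d) - p.2‖ ^ 2 / (2 * τ) := by fun_prop
  obtain ⟨γ, hγ, hmin⟩ := exists_coupling_minimizing hc hF ν'
  have hfst (m : ProbabilityMeasure (S × S)) :
      ((m : Measure (S × S)).map (Prod.map Subtype.val Subtype.val)).map Prod.fst =
        ((m : Measure (S × S)).map Prod.fst).map Subtype.val := by
    rw [Measure.map_map measurable_fst hemb₂.measurable,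
      Measure.map_map hemb.measurable measurable_fst]
    rfl
  have hsnd (m : ProbabilityMeasure (S × S)) :
      ((m : Measure (S × S)).map (Prod.map Subtype.val Subtype.val)).map Prod.snd =
        ((m : Measure (S × S)).map Prod.snd).map Subtype.val := by
    rw [Measure.map_map measurable_snd hemb₂.measurable,
      Measure.map_map hemb.measurable measurable_snd]
    rfl
  have hprob (m : ProbabilityMeasure S) :
      IsProbabilityMeasure ((m : Measure S).map Subtype.val) :=
    Measure.isProbabilityMeasure_map hemb.measurable.aemeasurable
  refine ⟨((γ.map measurable_fst.aemeasurable : ProbabilityMeasure S) : Measure S).map Subtype.val,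
    hprob _, ?_, fun μ hμ hμS => ?_⟩
  · rw [hemb.map_apply]
    simp
  obtain ⟨μ', rfl⟩ := hemb.exists_probabilityMeasure_map_eq μ (by simpa using hμS)
  simp only [hemb.integral_map]
  have hγprob : IsProbabilityMeasure
      ((γ : Measure (S × S)).map (Prod.map Subtype.val Subtype.val : S × S → Ed d × Ed d)) :=
    Measure.isProbabilityMeasure_map hemb₂.measurable.aemeasurable
  have hupper := W2sq_le _ (hfst γ) ((hsnd γ).trans
    (congrArg (fun m : ProbabilityMeasure S => (m : Measure S).map Subtype.val) hγ))
  rw [hemb₂.integral_map] at hupper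
  have hτ₂ : 0 < 2 * τ := by positivity
  refine (add_le_add_left (div_le_div_of_nonneg_right hupper hτ₂.le) _).trans ?_
  rw [← sub_le_iff_le_add, le_div_iff₀ hτ₂]
  have := hprob μ'
  refine le_W2sq fun π hπ hπfst hπsnd => ?_
  have hπS : π (range (Prod.map Subtype.val Subtype.val : S × S → Ed d × Ed d))ᶜ = 0 := by
    have h₁ : ∀ᵐ p ∂π, p.1 ∈ S := by
      refine ae_of_ae_map (p := fun x => x ∈ S) measurable_fst.aemeasurable ?_
      rw [hπfst]
      exact mem_ae_iff.2 hμS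
    have h₂ : ∀ᵐ p ∂π, p.2 ∈ S := by
      refine ae_of_ae_map (p := fun x => x ∈ S) measurable_snd.aemeasurable ?_
      rw [hπsnd]
      exact mem_ae_iff.2 hν
    refine mem_ae_iff.1 ?_
    filter_upwards [h₁, h₂] with p hp₁ hp₂
    exact ⟨(⟨p.1, hp₁⟩, ⟨p.2, hp₂⟩), rfl⟩
  obtain ⟨π', rfl⟩ := hemb₂.exists_probabilityMeasure_map_eq π hπS
  have hinj {m n : ProbabilityMeasure S}
      (h : (m : Measure S).map Subtype.val = (n : Measure S).map Subtype.val) : m = n := by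
    refine ProbabilityMeasure.toMeasure_injective ?_
    rw [← hemb.comap_map (m : Measure S), h, hemb.comap_map]
  have hπ₁ : π'.map measurable_fst.aemeasurable = μ' := hinj ((hfst π').symm.trans hπfst)
  have hπ₂ : π'.map measurable_snd.aemeasurable = ν' := hinj ((hsnd π').symm.trans hπsnd)
  have hle := hmin π' hπ₂
  rw [hπ₁, integral_div, integral_div] at hle
  rw [hemb₂.integral_map, ← le_div_iff₀ hτ₂, sub_le_iff_le_add]
  exact hle

end
end
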